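/- Let F(x) ∈ ℤ[x] be a polynomial with at least two distinct complex roots. Suppose there exist constants μ > 0 and C > 0 such that for all but finitely many n ∈ ℤ with F(n) ≠ 0 one has ∏_{p prime, p ∣ F(n)} ν_p(F(n)) ≤ C · rad(F(n))^μ. Then there exists a constant κ > 0 (depending only on F) such that for every n ∈ ℤ with F(n) ≠ 0 one has log |n| ≤ exp( κ · sqrt( (log* rad F(n)) · (log₂* rad F(n)) ) ). -/

import Mathlib

/-- The `k`-th iterate of the natural logarithm, clamped to `1` whenever the
(mathematical) value is undefined or smaller than `1`; `iterLogStar 1 = log*`. -/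
noncomputable def iterLogStar : ℕ → ℝ → ℝ
  | 0, t => max 1 t
  | k + 1, t => max 1 (Real.log (iterLogStar k t))

/-- The radical of a nonzero integer: the product of its distinct prime divisors. -/
def intRadical (m : ℤ) : ℕ := ∏ p ∈ m.natAbs.primeFactors, p

/-- A function into `{0, …, N}` on a set of size `N` which is injective away from the value `N`
has sum at least `N (N - 1) / 2`. -/
theorem sum_range_le_sum_of_injOn {ι : Type*} [Fintype ι] (r : ι → ℕ)
    (hr : ∀ i j, r i = r j → r i < Fintype.card ι → i = j) :
    ∑ t ∈ Finset.range (Fintype.card ι), t ≤ ∑ i, r i := by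
  classical
  set N := Fintype.card ι with hN
  have h1 : ∀ i, (∑ t ∈ Finset.range N, if t < r i then 1 else 0) ≤ r i := by
    intro i
    rw [← Finset.card_filter]
    calc _ ≤ (Finset.range (r i)).card := Finset.card_le_card (by intro t; simp)
      _ = r i := by simp
  have h2 : ∀ t ∈ Finset.range N, N - 1 - t ≤ ∑ i, if t < r i then 1 else 0 := by
    intro t ht
    rw [← Finset.card_filter]
    have h3 : (Finset.univ.filter fun i => ¬ t < r i).card ≤ (Finset.range (t + 1)).card := by
      apply Finset.card_le_card_of_injOn r
      · intro i hi
        simp at hi ⊢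
        omega
      · intro i hi j hj hij
        simp at hi hj ht
        exact hr i j hij (by omega)
    have h4 := Finset.card_filter_add_card_filter_not (s := (Finset.univ : Finset ι))
      (fun i => t < r i)
    simp only [Finset.card_range, Finset.card_univ] at h3 h4
    omega
  calc ∑ t ∈ Finset.range N, t = ∑ t ∈ Finset.range N, (N - 1 - t) :=
        (Finset.sum_range_reflect (fun t => t) N).symm
    _ ≤ ∑ t ∈ Finset.range N, ∑ i, (if t < r i then 1 else 0) := Finset.sum_le_sum h2
    _ = ∑ i, ∑ t ∈ Finset.range N, (if t < r i then 1 else 0) := Finset.sum_comm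
    _ ≤ ∑ i, r i := Finset.sum_le_sum fun i _ => h1 i

/-- Upper bound for a determinant whose rows are sums of pieces of geometrically decreasing size,
all pieces of the same (non-final) index being proportional to one vector. -/
theorem norm_det_le_of_rows {ι : Type*} [Fintype ι] [DecidableEq ι] {N : ℕ}
    (hN : Fintype.card ι = N) (A : Matrix ι ι ℂ) {X : ℝ}
    (hX : 0 ≤ X) (V : ι → Fin (N + 1) → ι → ℂ) (hA : ∀ j i, A j i = ∑ m, V j m i)
    (x : ι → Fin (N + 1) → ℂ) (c : Fin (N + 1) → ι → ℂ)
    (hV : ∀ j m i, m ≠ Fin.last _ → V j m i = x j m * c m i)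
    (hb : ∀ j m i, ‖V j m i‖ ≤ X * Real.exp (-(m : ℕ))) :
    ‖A.det‖ ≤ (N + 1 : ℝ) ^ N * (N.factorial *
      (X ^ N * Real.exp (-((∑ t ∈ Finset.range N, t : ℕ) : ℝ)))) := by
  set B : ℝ := (N.factorial : ℝ) * (X ^ N *
        Real.exp (-((∑ t ∈ Finset.range N, t : ℕ) : ℝ))) with hB
  have hB0 : 0 ≤ B := by positivity
  have hdet : A.det = ∑ r : ι → Fin (N + 1), Matrix.det (Matrix.of fun j => V j (r j)) := by
    have : A = Matrix.of fun j => ∑ m, V j m := by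
      ext j i
      simp [hA]
    rw [this]
    exact (Matrix.detRowAlternating (R := ℂ) (n := ι)).toMultilinearMap.map_sum
      (g := fun j m => V j m)
  have hterm : ∀ r : ι → Fin (N + 1), ‖Matrix.det (Matrix.of fun j => V j (r j))‖ ≤ B := by
    intro r
    by_cases hr : ∀ i j, (r i : ℕ) = r j → (r i : ℕ) < N → i = j
    · have hsum := sum_range_le_sum_of_injOn (fun i => (r i : ℕ)) (by rwa [hN])
      rw [hN] at hsum
      rw [Matrix.det_apply]
      calc _ ≤ ∑ σ : Equiv.Perm ι, ‖Equiv.Perm.sign σ • ∏ i, V (σ i) (r (σ i)) i‖ :=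
            norm_sum_le _ _
        _ ≤ ∑ σ : Equiv.Perm ι, (X ^ N *
              Real.exp (-((∑ t ∈ Finset.range N, t : ℕ) : ℝ))) := by
            refine Finset.sum_le_sum fun σ _ => ?_
            have h1 : ‖Equiv.Perm.sign σ • ∏ i, V (σ i) (r (σ i)) i‖
                = ∏ i, ‖V (σ i) (r (σ i)) i‖ := by
              rcases Int.units_eq_one_or (Equiv.Perm.sign σ) with h | h <;> simp [h, norm_prod]
            rw [h1]
            calc _ ≤ ∏ i, (X * Real.exp (-((r (σ i) : ℕ) : ℝ))) :=
                  Finset.prod_le_prod (fun _ _ => norm_nonneg _) fun i _ => hb _ _ _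
              _ = ∏ i, (X * Real.exp (-((r i : ℕ) : ℝ))) :=
                  Equiv.prod_comp σ (fun i => X * Real.exp (-((r i : ℕ) : ℝ)))
              _ = X ^ N * Real.exp (-((∑ i, (r i : ℕ) : ℕ) : ℝ)) := by
                  rw [Finset.prod_mul_distrib, ← Real.exp_sum]
                  simp [hN]
              _ ≤ _ := by
                  gcongr
        _ = B := by
            rw [Finset.sum_const, Finset.card_univ, Fintype.card_perm, nsmul_eq_mul, hN]
    · push Not at hr
      obtain ⟨i, j, hij, hlt, hne⟩ := hr
      have hzero : Matrix.det (Matrix.of fun j => V j (r j)) = 0 := by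
        let y : ι → ℂ := fun j => if r j = Fin.last _ then 1 else x j (r j)
        let w : ι → ι → ℂ := fun j => if r j = Fin.last _ then V j (r j) else c (r j)
        have hyw : (fun j => V j (r j)) = fun j => y j • w j := by
          funext j
          by_cases h : r j = Fin.last _
          · simp [y, w, h]
          · simp only [y, w, h, if_false]
            funext i
            exact hV _ _ _ h
        have hms := (Matrix.detRowAlternating (R := ℂ) (n := ι)).toMultilinearMap.map_smul_univ y w
        have hmat : (Matrix.of fun j => V j (r j)) = Matrix.of fun j => y j • w j := by
          rw [hyw]
        rw [hmat]
        refine (hms.trans ?_)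
        have hrij : r i = r j := Fin.ext hij
        have hil : r i ≠ Fin.last _ := by
          intro h
          rw [h] at hlt
          simp at hlt
        have : Matrix.det (Matrix.of w) = 0 := by
          apply Matrix.det_zero_of_row_eq hne
          funext k
          simp only [Matrix.of_apply, w, ← hrij, hil, if_false]
        exact (congrArg _ this).trans (smul_zero _)
      rw [hzero, norm_zero]
      exact hB0
  rw [hdet]
  calc _ ≤ ∑ r : ι → Fin (N + 1), ‖Matrix.det (Matrix.of fun j => V j (r j))‖ := norm_sum_le _ _
    _ ≤ ∑ r : ι → Fin (N + 1), B := Finset.sum_le_sum fun r _ => hterm r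
    _ = _ := by
      rw [Finset.sum_const, Finset.card_univ, Fintype.card_fun, Fintype.card_fin, nsmul_eq_mul]
      simp [hN]

theorem norm_exp_sub_sum_le_exp_neg_mul (x : ℂ) (T : ℕ) :
    ‖Complex.exp x - ∑ t ∈ Finset.range T, x ^ t / (t.factorial : ℂ)‖ ≤
      Real.exp (-T) * Real.exp (Real.exp 1 * ‖x‖) := by
  refine (Complex.norm_exp_sub_sum_le_exp_norm_sub_sum x T).trans ?_
  have hs : ∀ y : ℝ, HasSum (fun n : ℕ => y ^ n / n.factorial) (Real.exp y) := fun y => by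
    rw [Real.exp_eq_exp_ℝ]
    exact NormedSpace.expSeries_div_hasSum_exp y
  set y := ‖x‖ with hy
  have hy0 : 0 ≤ y := norm_nonneg _
  have h1 := (hasSum_nat_add_iff' T).2 (hs y)
  have h2 := (hs (Real.exp 1 * y))
  have h3 := ((hasSum_nat_add_iff' T).2 h2).mul_left (Real.exp (-T))
  refine (hasSum_le (fun n => ?_) h1 h3).trans ?_
  · rw [mul_pow, ← Real.exp_nat_mul, mul_div_assoc, ← mul_assoc, ← Real.exp_add]
    have : 1 ≤ Real.exp (-(T : ℝ) + ((n + T : ℕ) : ℝ) * 1) := by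
      apply Real.one_le_exp
      push_cast
      linarith [(Nat.cast_nonneg n : (0 : ℝ) ≤ n)]
    exact le_mul_of_one_le_left (by positivity) this
  · gcongr
    rw [sub_le_self_iff]
    exact Finset.sum_nonneg fun i _ => by positivity

/-- Determinants of the functions `z ^ k * exp (l * w * z)` at points of size at most `Z`, up to a
small perturbation, are extremely small. -/
theorem norm_det_pow_mul_pow_le {ι : Type*} [Fintype ι] [DecidableEq ι] {N K D : ℕ}
    (hN : Fintype.card ι = N) (hKN : K ≤ N) (k l : ι → ℕ) (hk : ∀ i, k i ≤ K) (hl : ∀ i, l i ≤ D)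
    (z Y : ι → ℂ) (w : ℂ) {Z : ℝ} (hZ : 1 ≤ Z) (hz : ∀ j, ‖z j‖ ≤ Z)
    (hY : ∀ j i, ‖Y j ^ l i - Complex.exp (l i * w * z j)‖ ≤
      Real.exp (-N) * Real.exp (Real.exp 1 * (D * ‖w‖ * Z))) :
    ‖(Matrix.of fun j i => z j ^ k i * Y j ^ l i).det‖ ≤ (N + 1 : ℝ) ^ N * (N.factorial *
      ((2 * ((Real.exp 1 * Z) ^ K * Real.exp (Real.exp 1 * (D * ‖w‖ * Z)))) ^ N *
        Real.exp (-((∑ t ∈ Finset.range N, t : ℕ) : ℝ)))) := by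
  set E : ℝ := Real.exp (Real.exp 1 * (D * ‖w‖ * Z)) with hE
  have hE1 : 1 ≤ E := Real.one_le_exp (by positivity)
  have he1 : 1 ≤ Real.exp 1 := Real.one_le_exp (by norm_num)
  set X : ℝ := (Real.exp 1 * Z) ^ K * E with hX
  have hX0 : 0 ≤ X := by positivity
  have heZ : 1 ≤ Real.exp 1 * Z := one_le_mul_of_one_le_of_one_le he1 hZ
  let c : Fin (N + 1) → ι → ℂ := fun m i =>
    if k i ≤ (m : ℕ) then (l i * w) ^ ((m : ℕ) - k i) / (((m : ℕ) - k i).factorial : ℂ) else 0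
  let V : ι → Fin (N + 1) → ι → ℂ := fun j m i =>
    if m = Fin.last N then z j ^ k i * Y j ^ l i - ∑ t : Fin N, z j ^ (t : ℕ) * c t.castSucc i
    else z j ^ (m : ℕ) * c m i
  have hnorm : ∀ j i, ‖(l i : ℂ) * w * z j‖ ≤ D * ‖w‖ * Z := by
    intro j i
    rw [norm_mul, norm_mul, Complex.norm_natCast]
    have : (l i : ℝ) ≤ D := by exact_mod_cast hl i
    have := hz j
    gcongr
  have hEle : ∀ j i, Real.exp (Real.exp 1 * ‖(l i : ℂ) * w * z j‖) ≤ E := fun j i =>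
    Real.exp_le_exp.2 (mul_le_mul_of_nonneg_left (hnorm j i) (by positivity))
  have hKle : ∀ i, (Real.exp 1 * Z) ^ k i ≤ (Real.exp 1 * Z) ^ K := fun i =>
    pow_le_pow_right₀ heZ (hk i)
  have hzc : ∀ j (m : Fin (N + 1)) i, k i ≤ (m : ℕ) → z j ^ (m : ℕ) * c m i =
      z j ^ k i * ((l i * w * z j) ^ ((m : ℕ) - k i) / (((m : ℕ) - k i).factorial : ℂ)) := by
    intro j m i h
    simp only [c, h, if_true]
    obtain ⟨t, ht⟩ := Nat.exists_eq_add_of_le h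
    rw [ht, Nat.add_sub_cancel_left, pow_add, mul_pow _ (z j)]
    ring
  have hpow : ∀ j i, ‖z j ^ k i‖ ≤ Z ^ k i := by
    intro j i
    rw [norm_pow]
    exact pow_le_pow_left₀ (norm_nonneg _) (hz j) _
  refine norm_det_le_of_rows hN _ (X := 2 * X) (by positivity) V ?_ (fun j m => z j ^ (m : ℕ)) c
    ?_ ?_
  · intro j i
    rw [Fin.sum_univ_castSucc]
    simp only [V, Matrix.of_apply, if_true]
    simp [Fin.castSucc_ne_last]
  · intro j m i hm
    simp only [V, hm, if_false]
  · intro j m i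
    by_cases hm : m = Fin.last N
    · simp only [V, hm, if_true]
      have hkN : k i ≤ N := (hk i).trans hKN
      have hsum : ∑ t : Fin N, z j ^ (t : ℕ) * c t.castSucc i = z j ^ k i *
          ∑ t ∈ Finset.range (N - k i), (l i * w * z j) ^ t / (t.factorial : ℂ) := by
        have h1 : ∑ t : Fin N, z j ^ (t : ℕ) * c t.castSucc i = ∑ t ∈ Finset.range N,
            if k i ≤ t then z j ^ k i * ((l i * w * z j) ^ (t - k i) / ((t - k i).factorial : ℂ))
            else 0 := by
          rw [← Fin.sum_univ_eq_sum_range (fun t => if k i ≤ t then z j ^ k i *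
            ((l i * w * z j) ^ (t - k i) / ((t - k i).factorial : ℂ)) else 0)]
          refine Finset.sum_congr rfl fun t _ => ?_
          by_cases h : k i ≤ (t : ℕ)
          · rw [if_pos h]
            exact hzc j t.castSucc i h
          · simp [c, h]
        rw [h1]
        obtain ⟨M, hM⟩ := Nat.exists_eq_add_of_le hkN
        rw [hM, Finset.sum_range_add, Nat.add_sub_cancel_left, Finset.mul_sum,
          Finset.sum_eq_zero, zero_add]
        · refine Finset.sum_congr rfl fun t _ => ?_
          simp
        · intro t ht
          rw [if_neg (by simpa using ht)]
      rw [hsum, ← mul_sub, norm_mul]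
      have h2 : ‖Y j ^ l i - ∑ t ∈ Finset.range (N - k i), (l i * w * z j) ^ t /
          (t.factorial : ℂ)‖ ≤ Real.exp (-N) * E + Real.exp (-((N - k i : ℕ) : ℝ)) * E := by
        refine (norm_sub_le_norm_sub_add_norm_sub _ (Complex.exp (l i * w * z j)) _).trans ?_
        refine add_le_add (hY j i) ((norm_exp_sub_sum_le_exp_neg_mul _ _).trans ?_)
        exact mul_le_mul_of_nonneg_left (hEle j i) (Real.exp_pos _).le
      have h3 : Real.exp (-N) * E ≤ Real.exp (-((N - k i : ℕ) : ℝ)) * E := by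
        refine mul_le_mul_of_nonneg_right (Real.exp_le_exp.2 ?_) (by positivity)
        have : ((N - k i : ℕ) : ℝ) ≤ N := by exact_mod_cast Nat.sub_le _ _
        linarith
      have h4 : Real.exp (-((N - k i : ℕ) : ℝ)) = Real.exp 1 ^ k i * Real.exp (-N) := by
        rw [← Real.exp_nat_mul, ← Real.exp_add, Nat.cast_sub hkN]
        congr 1
        ring
      calc _ ≤ Z ^ k i * (2 * (Real.exp (-((N - k i : ℕ) : ℝ)) * E)) := by
            refine mul_le_mul (hpow j i) (h2.trans (by linarith)) (norm_nonneg _) (by positivity)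
        _ = 2 * ((Real.exp 1 * Z) ^ k i * E) * Real.exp (-N) := by
            rw [h4, mul_pow]
            ring
        _ ≤ 2 * X * Real.exp (-(Fin.last N : Fin (N + 1))) := by
            rw [Fin.val_last]
            exact mul_le_mul_of_nonneg_right (mul_le_mul_of_nonneg_left
              (mul_le_mul_of_nonneg_right (hKle i) (by positivity)) zero_le_two) (Real.exp_pos _).le
    · simp only [V, hm, if_false]
      by_cases h : k i ≤ (m : ℕ)
      · rw [hzc j m i h, norm_mul, norm_div, norm_pow (_ * _), Complex.norm_natCast]
        have h5 : Real.exp (-((m : ℕ) : ℝ)) * Real.exp 1 ^ k i *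
            Real.exp 1 ^ ((m : ℕ) - k i) = 1 := by
          rw [mul_assoc, ← pow_add, Nat.add_sub_cancel' h, ← Real.exp_nat_mul, ← Real.exp_add]
          simp
        have h6 : (Real.exp 1 * (D * ‖w‖ * Z)) ^ ((m : ℕ) - k i) / ((m : ℕ) - k i).factorial ≤ E :=
          Real.pow_div_factorial_le_exp _ (by positivity) _
        calc _ ≤ Z ^ k i * ((D * ‖w‖ * Z) ^ ((m : ℕ) - k i) / ((m : ℕ) - k i).factorial) := by
              have h1 := hnorm j i
              have h2 := hpow j i
              gcongr
          _ = (Real.exp (-((m : ℕ) : ℝ)) * Real.exp 1 ^ k i * Real.exp 1 ^ ((m : ℕ) - k i)) *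
              (Z ^ k i * ((D * ‖w‖ * Z) ^ ((m : ℕ) - k i) / ((m : ℕ) - k i).factorial)) := by
              rw [h5, one_mul]
          _ = (Real.exp 1 * Z) ^ k i * ((Real.exp 1 * (D * ‖w‖ * Z)) ^ ((m : ℕ) - k i) /
                ((m : ℕ) - k i).factorial) * Real.exp (-((m : ℕ) : ℝ)) := by
              rw [mul_pow (Real.exp 1) Z, mul_pow (Real.exp 1) (D * ‖w‖ * Z)]
              ring
          _ ≤ (Real.exp 1 * Z) ^ K * E * Real.exp (-((m : ℕ) : ℝ)) := by
              exact mul_le_mul_of_nonneg_right (mul_le_mul (hKle i) h6 (by positivity)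
                (by positivity)) (Real.exp_pos _).le
          _ ≤ 2 * X * Real.exp (-((m : ℕ) : ℝ)) := by
              exact mul_le_mul_of_nonneg_right (by linarith) (Real.exp_pos _).le
      · simp only [c, h, if_false, mul_zero, norm_zero]
        positivity

theorem Matrix.exists_det_submatrix_ne_zero {F m n : Type*} [Field F] [Fintype m] [Fintype n]
    [DecidableEq n] (A : Matrix m n F) (hA : ∀ v, A.mulVec v = 0 → v = 0) :
    ∃ f : n → m, (A.submatrix f id).det ≠ 0 := by
  classical
  have hinj : Function.Injective A.mulVec := by
    intro v w h
    have := hA (v - w) (by rw [Matrix.mulVec_sub]; exact sub_eq_zero.2 h)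
    exact sub_eq_zero.1 this
  have hrank : A.rank = Fintype.card n := by
    rw [Matrix.rank_eq_finrank_span_cols]
    exact finrank_span_eq_card (Matrix.mulVec_injective_iff.1 hinj)
  obtain ⟨κ, a, ha, hspan, hli⟩ := exists_linearIndependent' F A.row
  have : Fintype κ := Fintype.ofInjective a ha
  have hcard : Fintype.card κ = Fintype.card n := by
    rw [← hrank, Matrix.rank_eq_finrank_span_row, ← hspan]
    exact (finrank_span_eq_card hli).symm
  let e : n ≃ κ := (Fintype.equivOfCardEq hcard).symm
  refine ⟨fun i => a (e i), ?_⟩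
  have h : LinearIndependent F (A.submatrix (fun i => a (e i)) id).row :=
    hli.comp e e.injective
  rw [Matrix.linearIndependent_rows_iff_isUnit, Matrix.isUnit_iff_isUnit_det] at h
  exact h.ne_zero

open Polynomial in
/-- A nontrivial exponential polynomial `∑ l, P l (z) * (η ^ z * y) ^ l` cannot vanish at
too many points. -/
theorem card_le_of_expPolynomial_eq_zero {F : Type*} [Field F] {D n : ℕ} (η : F) (hη : η ≠ 0)
    (hroot : ∀ t : ℕ, t ≠ 0 → η ^ t ≠ 1) (P : Fin D → F[X]) (hP : P ≠ 0)
    (hdeg : ∀ l, (P l).natDegree ≤ n) (Ω : Finset F)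
    (hvan : ∀ x ∈ Ω, ∃ y : F, y ≠ 0 ∧
      ∀ i < D, ∑ l, (P l).eval (x + i) * (η ^ i * y) ^ (l : ℕ) = 0) :
    Ω.card ≤ D * n := by
  classical
  let L := {l : Fin D // P l ≠ 0}
  let D0 := Fintype.card L
  have hD0 : D0 ≤ D := by
    exact (Fintype.card_subtype_le (fun l : Fin D => P l ≠ 0)).trans_eq (Fintype.card_fin D)
  let e : Fin D0 ≃ L := (Fintype.equivFin L).symm
  have hD0pos : 0 < D0 := by
    obtain ⟨l, hl⟩ := Function.ne_iff.1 hP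
    exact Fintype.card_pos_iff.2 ⟨⟨l, hl⟩⟩
  have hηl : Function.Injective (fun l : ℕ => η ^ l) := by
    intro a b h
    wlog hab : a ≤ b generalizing a b
    · exact (this h.symm (le_of_not_ge hab)).symm
    obtain ⟨t, rfl⟩ := Nat.exists_eq_add_of_le hab
    have h1 : η ^ a * η ^ t = η ^ a * 1 := by
      rw [← pow_add, mul_one]
      exact h.symm
    have h2 := mul_left_cancel₀ (pow_ne_zero a hη) h1
    by_contra hne
    exact hroot t (by rintro rfl; simp at hne) h2
  let M : Matrix (Fin D0) (Fin D0) F[X] := Matrix.of fun i j =>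
    (P (e j).1).comp (X + C ((i : ℕ) : F)) * C (η ^ ((i : ℕ) * ((e j).1 : ℕ)))
  have hcompne : ∀ i j : Fin D0, (P (e j).1).comp (X + C ((i : ℕ) : F)) ≠ 0 := by
    intro i j h
    rw [comp_eq_zero_iff] at h
    rcases h with h | ⟨_, h⟩
    · exact (e j).2 h
    · have := congrArg natDegree h
      rw [natDegree_X_add_C, natDegree_C] at this
      exact one_ne_zero this
  have hηC : ∀ t : ℕ, η ^ t ≠ 0 := fun t => pow_ne_zero _ hη
  have hMne : ∀ i j, M i j ≠ 0 := fun i j =>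
    mul_ne_zero (hcompne i j) (C_ne_zero.2 (hηC _))
  have hMdeg : ∀ i j, (M i j).natDegree = (P (e j).1).natDegree := by
    intro i j
    simp only [M, Matrix.of_apply]
    rw [natDegree_mul_C (hηC _), natDegree_comp, natDegree_X_add_C, mul_one]
  have hMlead : ∀ i j, (M i j).leadingCoeff =
      (P (e j).1).leadingCoeff * (η ^ ((e j).1 : ℕ)) ^ (i : ℕ) := by
    intro i j
    simp only [M, Matrix.of_apply]
    rw [leadingCoeff_mul, leadingCoeff_C,
      leadingCoeff_comp (by rw [natDegree_X_add_C]; exact one_ne_zero),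
      leadingCoeff_X_add_C,
      one_pow, mul_one, ← pow_mul, mul_comm ((e j).1 : ℕ)]
  set n0 := ∑ j, (P (e j).1).natDegree with hn0
  have hn0le : n0 ≤ D * n := by
    calc n0 ≤ ∑ _j : Fin D0, n := Finset.sum_le_sum fun j _ => hdeg _
      _ = D0 * n := by simp
      _ ≤ D * n := Nat.mul_le_mul_right _ hD0
  have hprod : ∀ σ : Equiv.Perm (Fin D0), (∏ j, M (σ j) j).natDegree = n0 := by
    intro σ
    rw [natDegree_prod _ _ fun j _ => hMne _ _]
    exact Finset.sum_congr rfl fun j _ => hMdeg _ _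
  have hcoeff : M.det.coeff n0 = (∏ j, (P (e j).1).leadingCoeff) *
      (Matrix.vandermonde fun j : Fin D0 => η ^ ((e j).1 : ℕ)).det := by
    rw [← Matrix.det_transpose (Matrix.vandermonde _), Matrix.det_apply, Matrix.det_apply,
      finsetSum_coeff, Finset.mul_sum]
    refine Finset.sum_congr rfl fun σ _ => ?_
    rw [coeff_smul, ← hprod σ, coeff_natDegree, leadingCoeff_prod, mul_smul_comm]
    congr 1
    rw [← Finset.prod_mul_distrib]
    exact Finset.prod_congr rfl fun j _ => hMlead _ _
  have hdetne : M.det ≠ 0 := by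
    intro h
    rw [h, coeff_zero, eq_comm, mul_eq_zero] at hcoeff
    rcases hcoeff with h | h
    · rw [Finset.prod_eq_zero_iff] at h
      obtain ⟨j, _, hj⟩ := h
      exact (e j).2 (leadingCoeff_eq_zero.1 hj)
    · refine Matrix.det_vandermonde_ne_zero_iff.2 ?_ h
      intro i j hij
      exact e.injective (Subtype.ext (Fin.ext (hηl hij)))
  have hdetdeg : M.det.natDegree ≤ n0 := by
    rw [Matrix.det_apply]
    refine natDegree_sum_le_of_forall_le _ _ fun σ _ => ?_
    exact (natDegree_smul_le _ _).trans (hprod σ).le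
  refine le_trans ?_ (hdetdeg.trans hn0le)
  by_contra! hlt
  refine hdetne (eq_zero_of_natDegree_lt_card_of_eval_eq_zero' _ Ω ?_ hlt)
  intro x hx
  obtain ⟨y, hy, hvan⟩ := hvan x hx
  rw [← coe_evalRingHom, RingHom.map_det]
  refine Matrix.exists_mulVec_eq_zero_iff.1 ⟨fun j => y ^ ((e j).1 : ℕ), ?_, ?_⟩
  · intro h
    exact pow_ne_zero _ hy (congrFun h ⟨0, hD0pos⟩)
  · funext i
    have h1 := hvan i (i.2.trans_le hD0)
    have h2 : ∑ l, (P l).eval (x + i) * (η ^ (i : ℕ) * y) ^ (l : ℕ) =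
        ∑ l : L, (P l.1).eval (x + i) * (η ^ (i : ℕ) * y) ^ (l.1 : ℕ) := by
      rw [← Fintype.sum_subtype_add_sum_subtype (fun l => P l ≠ 0)
        (fun l => (P l).eval (x + i) * (η ^ (i : ℕ) * y) ^ (l : ℕ)), add_eq_left]
      apply Fintype.sum_eq_zero
      intro l
      rw [not_not.1 l.2, eval_zero, zero_mul]
    rw [h2, ← e.sum_comp] at h1
    rw [Pi.zero_apply, ← h1, Matrix.mulVec, dotProduct]
    refine Finset.sum_congr rfl fun j _ => ?_
    simp only [M, RingHom.mapMatrix_apply, Matrix.map_apply, Matrix.of_apply, coe_evalRingHom,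
      eval_mul, eval_C, eval_comp, eval_add, eval_X]
    rw [mul_pow, ← pow_mul, mul_assoc]

theorem NumberField.exists_one_le_norm_map_of_isIntegral {K : Type*} [Field K] [NumberField K]
    {x : K} (hx : IsIntegral ℤ x) (hx0 : x ≠ 0) : ∃ σ : K →+* ℂ, 1 ≤ ‖σ x‖ := by
  apply NumberField.exists_conjugate_one_le_norm (K := K) (α := ⟨x, hx⟩)
  exact fun h => hx0 (congrArg Subtype.val h)

open Polynomial in
/-- The exponential polynomials in `z` and `Y = η ^ z * u ^ s'` are determined by their values on
a sufficiently large grid. -/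
theorem eq_zero_of_grid_vanishing {F : Type*} [Field F] [CharZero F] {r S S' K₀ D : ℕ}
    (hK₀ : 0 < K₀) (hD : 0 < D) (hSr : S ≤ r) (hcard : D * K₀ ≤ (S + 1 - D) * S') {η u : F}
    (hη : η ≠ 0) (hu : u ≠ 0) (hroot : ∀ t : ℕ, t ≠ 0 → η ^ t ≠ 1)
    (p : Fin K₀ × Fin D → F)
    (hp : ∀ (s : Fin S) (s' : Fin S'), ∑ i, ((s : F) - r * (s' : F)) ^ (i.1 : ℕ) *
      (η ^ (s : ℕ) * (u * (η ^ r)⁻¹) ^ (s' : ℕ)) ^ (i.2 : ℕ) * p i = 0) : p = 0 := by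
  classical
  let P : Fin D → F[X] := fun l => ∑ k : Fin K₀, C (p (k, l)) * X ^ (k : ℕ)
  have hPcoeff : ∀ (k : Fin K₀) l, (P l).coeff k = p (k, l) := by
    intro k l
    simp only [P, finsetSum_coeff, coeff_C_mul, coeff_X_pow]
    rw [Finset.sum_eq_single k]
    · simp
    · intro b _ hb
      rw [if_neg fun h => hb (Fin.ext h.symm), mul_zero]
    · simp
  by_contra hne
  have hP : P ≠ 0 := by
    intro h
    apply hne
    funext ⟨k, l⟩
    rw [← hPcoeff, h]
    simp
  have hdeg : ∀ l, (P l).natDegree ≤ K₀ - 1 := by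
    intro l
    refine natDegree_sum_le_of_forall_le _ _ fun k _ => ?_
    exact (natDegree_C_mul_X_pow_le _ _).trans (by have := k.2; omega)
  have heval : ∀ l x, (P l).eval x = ∑ k : Fin K₀, p (k, l) * x ^ (k : ℕ) := by
    intro l x
    simp [P, eval_finsetSum]
  let g : Fin (S + 1 - D) × Fin S' → F := fun q => (q.1 : F) - r * (q.2 : F)
  have hg : Function.Injective g := by
    rintro ⟨a, b⟩ ⟨c, d⟩ h
    have h1 : (a : F) + r * (d : F) = (c : F) + r * (b : F) := by
      simp only [g] at h
      linear_combination h
    have h2 : (a : ℕ) + r * (d : ℕ) = (c : ℕ) + r * (b : ℕ) := by exact_mod_cast h1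
    have ha : (a : ℕ) < r := by have := a.2; omega
    have hc : (c : ℕ) < r := by have := c.2; omega
    have h3 : (a : ℕ) = c := by
      have := congrArg (· % r) h2
      simpa [Nat.add_mul_mod_self_left, Nat.mod_eq_of_lt ha, Nat.mod_eq_of_lt hc] using this
    have h4 : (d : ℕ) = b := by
      have h5 : r * (d : ℕ) = r * (b : ℕ) := by omega
      exact Nat.eq_of_mul_eq_mul_left (by omega) h5
    exact Prod.ext (Fin.ext h3) (Fin.ext h4.symm)
  have key := card_le_of_expPolynomial_eq_zero η hη hroot P hP hdeg (Finset.univ.image g) (by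
    intro x hx
    obtain ⟨⟨s, s'⟩, _, rfl⟩ := Finset.mem_image.1 hx
    refine ⟨η ^ (s : ℕ) * (u * (η ^ r)⁻¹) ^ (s' : ℕ), ?_, ?_⟩
    · exact mul_ne_zero (pow_ne_zero _ hη) (pow_ne_zero _ (mul_ne_zero hu
        (inv_ne_zero (pow_ne_zero _ hη))))
    intro i hi
    have hsi : (s : ℕ) + i < S := by have := s.2; omega
    rw [← hp ⟨s + i, hsi⟩ s', Fintype.sum_prod_type_right]
    refine Finset.sum_congr rfl fun l _ => ?_
    rw [heval, Finset.sum_mul]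
    refine Finset.sum_congr rfl fun k _ => ?_
    simp only [g]
    rw [pow_add]
    push_cast
    ring)
  rw [Finset.card_image_of_injective _ hg, Finset.card_univ, Fintype.card_prod, Fintype.card_fin,
    Fintype.card_fin] at key
  have h6 := hcard.trans key
  have h7 := Nat.le_of_mul_le_mul_left h6 hD
  omega

theorem Complex.norm_pow_sub_one_le {u : ℂ} {ε : ℝ} (hu : ‖u - 1‖ ≤ ε) {n : ℕ}
    (hn : n * ε ≤ 1) : ‖u ^ n - 1‖ ≤ 2 * (n * ε) := by
  have hε : 0 ≤ ε := (norm_nonneg _).trans hu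
  have h1 : ‖u ^ n - 1‖ ≤ (1 + ε) ^ n - 1 := by
    clear hn
    induction n with
    | zero => simp
    | succ n ih =>
      have h2 : u ^ (n + 1) - 1 = (u ^ n - 1) * u + (u - 1) := by ring
      have h3 : ‖u‖ ≤ 1 + ε := by
        have := norm_add_le (1 : ℂ) (u - 1)
        simp only [add_sub_cancel, norm_one] at this
        linarith
      calc ‖u ^ (n + 1) - 1‖ ≤ ‖u ^ n - 1‖ * ‖u‖ + ‖u - 1‖ := by
            rw [h2, ← norm_mul]
            exact norm_add_le _ _
        _ ≤ ((1 + ε) ^ n - 1) * (1 + ε) + ε :=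
          add_le_add (mul_le_mul ih h3 (norm_nonneg _) ((norm_nonneg _).trans ih)) hu
        _ = (1 + ε) ^ (n + 1) - 1 := by ring
  have h4 : (1 + ε) ^ n ≤ Real.exp (n * ε) := by
    rw [Real.exp_nat_mul]
    gcongr
    linarith [Real.add_one_le_exp ε]
  have h5 : Real.exp (n * ε) ≤ 1 + 2 * (n * ε) := by
    have h0 : 0 ≤ n * ε := by positivity
    have := Real.abs_exp_sub_one_le (x := n * ε) (by rwa [abs_of_nonneg h0])
    rw [abs_of_nonneg h0] at this
    linarith [le_abs_self (Real.exp (n * ε) - 1)]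
  linarith

/-- If `η` is not a root of unity, `u` is extremely close to `1` at all complex embeddings and
`η` has small logarithms, then the denominators of `η` and of `u / η ^ r` cannot both be small. -/
theorem NumberField.half_le_of_near_one {K : Type*} [Field K] [NumberField K]
    {r S S' K₀ D mη ma : ℕ} (hK₀ : 0 < K₀) (hD : 0 < D) (hS' : 0 < S') (hSr : S ≤ r)
    (hcard : D * K₀ ≤ (S + 1 - D) * S') {η u : K}
    (hη : η ≠ 0) (hu : u ≠ 0) (hroot : ∀ t : ℕ, t ≠ 0 → η ^ t ≠ 1) (hmη : 0 < mη) (hma : 0 < ma)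
    (hηint : IsIntegral ℤ ((mη : K) * η)) (haint : IsIntegral ℤ ((ma : K) * (u * (η ^ r)⁻¹)))
    (w : (K →+* ℂ) → ℂ) (hw : ∀ σ, Complex.exp (w σ) = σ η) {δ ε : ℝ} (hδ : ∀ σ, ‖w σ‖ ≤ δ)
    (hε : ∀ σ : K →+* ℂ, ‖σ u - 1‖ ≤ ε)
    (hεN : 2 * (D * S') * ε ≤ Real.exp (-((K₀ * D : ℕ) : ℝ))) :
    (((K₀ * D : ℕ) : ℝ) - 1) / 2 ≤ D * (S * Real.log mη + S' * Real.log ma) +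
      2 * Real.log ((K₀ * D : ℕ) + 1) + Real.log 2 + K₀ * (1 + Real.log (S + r * S')) +
      Real.exp 1 * (D * δ * (S + r * S')) := by
  classical
  set N := K₀ * D with hN
  let ι := Fin K₀ × Fin D
  have hcardι : Fintype.card ι = N := by simp [ι, hN]
  set a := u * (η ^ r)⁻¹ with ha
  let A : Matrix (Fin S × Fin S') ι K := Matrix.of fun j i =>
    ((j.1 : K) - r * (j.2 : K)) ^ (i.1 : ℕ) * (η ^ (j.1 : ℕ) * a ^ (j.2 : ℕ)) ^ (i.2 : ℕ)
  obtain ⟨f, hf⟩ := A.exists_det_submatrix_ne_zero fun p hp =>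
    eq_zero_of_grid_vanishing hK₀ hD hSr hcard hη hu hroot p fun s s' => congrFun hp (s, s')
  set m := (mη ^ S * ma ^ S') ^ D with hm
  have hm0 : 0 < m := by positivity
  have hinteg : ∀ j i, IsIntegral ℤ ((m : K) * A j i) := by
    rintro ⟨s, s'⟩ ⟨k, l⟩
    have h1 : ∃ c : ℕ, (m : K) * A (s, s') (k, l) = c * ((s : K) - r * (s' : K)) ^ (k : ℕ) *
        (((mη * η) ^ (s : ℕ)) * ((ma * a) ^ (s' : ℕ))) ^ (l : ℕ) := by
      obtain ⟨d1, hd1⟩ := Nat.exists_eq_add_of_le s.2.le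
      obtain ⟨d2, hd2⟩ := Nat.exists_eq_add_of_le s'.2.le
      obtain ⟨d3, hd3⟩ := Nat.exists_eq_add_of_le l.2.le
      refine ⟨(mη ^ d1 * ma ^ d2) ^ (l : ℕ) * (mη ^ S * ma ^ S') ^ d3, ?_⟩
      have h2 : m = (mη ^ (s : ℕ) * ma ^ (s' : ℕ)) ^ (l : ℕ) *
          ((mη ^ d1 * ma ^ d2) ^ (l : ℕ) * (mη ^ S * ma ^ S') ^ d3) := by
        rw [hm]
        conv_lhs => rw [hd3, pow_add]
        rw [← mul_assoc, ← mul_pow]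
        congr 2
        conv_lhs => rw [hd1, hd2]
        ring
      simp only [A, Matrix.of_apply]
      rw [h2]
      push_cast
      ring
    obtain ⟨c, hc⟩ := h1
    rw [hc]
    have h3 : ∀ n : ℕ, IsIntegral ℤ (n : K) := fun n => isIntegral_natCast n
    exact ((h3 c).mul (((h3 _).sub ((h3 _).mul (h3 _))).pow _)).mul
      (((hηint.pow _).mul (haint.pow _)).pow _)
  have hdetint : IsIntegral ℤ ((m : K) ^ N * (A.submatrix f id).det) := by
    rw [← hcardι, ← Matrix.det_smul]
    exact IsIntegral.det fun j i => hinteg _ _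
  have hmK : (m : K) ≠ 0 := by exact_mod_cast hm0.ne'
  obtain ⟨σ, hσ⟩ := NumberField.exists_one_le_norm_map_of_isIntegral hdetint
    (mul_ne_zero (pow_ne_zero _ hmK) hf)
  rw [map_mul, map_pow, map_natCast, norm_mul, norm_pow, Complex.norm_natCast,
    RingHom.map_det] at hσ
  have hr : 0 < r := by
    rcases Nat.eq_zero_or_pos r with h | h
    · subst h
      have h1 : S = 0 := by omega
      subst h1
      have : (0 + 1 - D) = 0 := by omega
      rw [this, zero_mul] at hcard
      have : 0 < D * K₀ := by positivity
      omega
    · exact h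
  set Z : ℝ := S + r * S' with hZ
  have hZ1 : 1 ≤ Z := by
    have h1 : (1 : ℝ) ≤ r := by exact_mod_cast hr
    have h2 : (1 : ℝ) ≤ S' := by exact_mod_cast hS'
    have h3 : (0 : ℝ) ≤ S := Nat.cast_nonneg _
    nlinarith
  have hε0 : 0 ≤ ε := (norm_nonneg _).trans (hε σ)
  have hδ0 : 0 ≤ δ := (norm_nonneg _).trans (hδ σ)
  let z : ι → ℂ := fun j => ((f j).1 : ℂ) - r * ((f j).2 : ℂ)
  let Y : ι → ℂ := fun j => σ (η ^ ((f j).1 : ℕ) * a ^ ((f j).2 : ℕ))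
  have hYeq : ∀ j, Y j = Complex.exp (w σ * z j) * σ u ^ ((f j).2 : ℕ) := by
    intro j
    simp only [Y, z, ha]
    rw [mul_sub, Complex.exp_sub, mul_comm (w σ), Complex.exp_nat_mul, hw,
      show w σ * (r * ((f j).2 : ℂ)) = ((r * (f j).2 : ℕ) : ℂ) * w σ by push_cast; ring,
      Complex.exp_nat_mul, hw, map_mul, map_pow, map_pow, map_mul, map_inv₀, map_pow, mul_pow,
      inv_pow, ← pow_mul]
    ring
  have hzn : ∀ j, ‖z j‖ ≤ Z := by
    intro j
    refine (norm_sub_le _ _).trans ?_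
    rw [norm_mul, Complex.norm_natCast, Complex.norm_natCast, Complex.norm_natCast]
    have h1 : ((f j).1 : ℝ) ≤ S := by exact_mod_cast (f j).1.2.le
    have h2 : ((f j).2 : ℝ) ≤ S' := by exact_mod_cast (f j).2.2.le
    rw [hZ]
    gcongr
  have hdet : (σ.mapMatrix (A.submatrix f id)) =
      Matrix.of fun j (i : ι) => z j ^ (i.1 : ℕ) * Y j ^ (i.2 : ℕ) := by
    ext j i
    simp [A, z, Y]
  have hYb : ∀ j (i : ι), ‖Y j ^ (i.2 : ℕ) - Complex.exp ((i.2 : ℕ) * w σ * z j)‖ ≤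
      Real.exp (-N) * Real.exp (Real.exp 1 * (D * ‖w σ‖ * Z)) := by
    intro j i
    have h1 : Y j ^ (i.2 : ℕ) - Complex.exp ((i.2 : ℕ) * w σ * z j) =
        (σ u ^ (((f j).2 : ℕ) * (i.2 : ℕ)) - 1) * Complex.exp ((i.2 : ℕ) * w σ * z j) := by
      rw [hYeq, mul_pow, mul_assoc ((i.2 : ℕ) : ℂ), Complex.exp_nat_mul, pow_mul]
      ring
    have hl : ((i.2 : ℕ) : ℝ) ≤ D := by exact_mod_cast i.2.2.le
    have hs : (((f j).2 : ℕ) : ℝ) ≤ S' := by exact_mod_cast (f j).2.2.le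
    have h2 : ((((f j).2 : ℕ) * (i.2 : ℕ) : ℕ) : ℝ) * ε ≤ (D * S') * ε := by
      push_cast
      rw [mul_comm (D : ℝ)]
      gcongr
    have hexp1 : Real.exp (-N) ≤ 1 := Real.exp_le_one_iff.2 (by
      have : (0 : ℝ) ≤ N := Nat.cast_nonneg _
      linarith)
    have h0 : 0 ≤ (D * S') * ε := by positivity
    rw [h1, norm_mul]
    refine mul_le_mul ?_ ?_ (norm_nonneg _) (Real.exp_pos _).le
    · refine (Complex.norm_pow_sub_one_le (hε σ) (by linarith)).trans ?_
      linarith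
    · refine (Complex.norm_exp_le_exp_norm _).trans (Real.exp_le_exp.2 ?_)
      rw [norm_mul, norm_mul, Complex.norm_natCast]
      have h3 := hzn j
      have h4 : (1 : ℝ) ≤ Real.exp 1 := Real.one_le_exp (by norm_num)
      calc ((i.2 : ℕ) : ℝ) * ‖w σ‖ * ‖z j‖ ≤ D * ‖w σ‖ * Z := by gcongr
        _ ≤ Real.exp 1 * (D * ‖w σ‖ * Z) := le_mul_of_one_le_left (by positivity) h4
  have hbound := norm_det_pow_mul_pow_le hcardι (K := K₀) (D := D)
    (by rw [hN]; exact Nat.le_mul_of_pos_right _ hD)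
    (fun i : ι => (i.1 : ℕ)) (fun i : ι => (i.2 : ℕ)) (fun i => i.1.2.le) (fun i => i.2.2.le)
    z Y (w σ) hZ1 hzn hYb
  rw [← hdet] at hbound
  have hNpos : 0 < N := by positivity
  have hNR : (0 : ℝ) < N := by exact_mod_cast hNpos
  have hfact : (N.factorial : ℝ) ≤ (N + 1 : ℝ) ^ N := by
    have h1 : N.factorial ≤ (N + 1) ^ N := (Nat.factorial_le_pow N).trans
      (Nat.pow_le_pow_left (Nat.le_succ N) N)
    exact_mod_cast h1
  have hsum : ((∑ t ∈ Finset.range N, t : ℕ) : ℝ) = N * ((N - 1) / 2) := by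
    have h1 := Finset.sum_range_id_mul_two N
    have h2 : ((∑ t ∈ Finset.range N, t : ℕ) : ℝ) * 2 = N * (N - 1) := by
      have : (((∑ t ∈ Finset.range N, t) * 2 : ℕ) : ℝ) = ((N * (N - 1) : ℕ) : ℝ) := by rw [h1]
      rw [Nat.cast_mul, Nat.cast_mul, Nat.cast_sub hNpos] at this
      simpa using this
    linarith
  set X : ℝ := 2 * ((Real.exp 1 * Z) ^ K₀ * Real.exp (Real.exp 1 * (D * ‖w σ‖ * Z))) with hX
  have hX0 : 0 < X := by positivity
  have hmR : (0 : ℝ) < m := by exact_mod_cast hm0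
  have htotal : (1 : ℝ) ≤ ((m : ℝ) * ((N + 1 : ℝ) * ((N + 1 : ℝ) * (X *
      Real.exp (-((N - 1) / 2)))))) ^ N := by
    calc (1 : ℝ) ≤ (m : ℝ) ^ N * ‖(σ.mapMatrix (A.submatrix f id)).det‖ := hσ
      _ ≤ (m : ℝ) ^ N * ((N + 1 : ℝ) ^ N * ((N + 1 : ℝ) ^ N * (X ^ N *
          Real.exp (-((∑ t ∈ Finset.range N, t : ℕ) : ℝ))))) := by
        refine mul_le_mul_of_nonneg_left (hbound.trans ?_) (by positivity)
        gcongr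
      _ = _ := by
        rw [hsum, ← mul_neg, Real.exp_nat_mul]
        simp only [mul_pow]
  have htotal' := (one_le_pow_iff_of_nonneg (by positivity) hNpos.ne').1 htotal
  have hlog := Real.log_nonneg htotal'
  rw [Real.log_mul (by positivity) (by positivity), Real.log_mul (by positivity) (by positivity),
    Real.log_mul (by positivity) (by positivity), Real.log_mul (by positivity) (by positivity),
    Real.log_exp, hX, Real.log_mul (by positivity) (by positivity),
    Real.log_mul (by positivity) (by positivity), Real.log_exp, Real.log_pow,
    Real.log_mul (by positivity) (by positivity), Real.log_exp] at hlog
  have hlogm : Real.log m = D * (S * Real.log mη + S' * Real.log ma) := by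
    rw [hm]
    push_cast
    rw [Real.log_pow, Real.log_mul (by positivity) (by positivity), Real.log_pow, Real.log_pow]
  have hfin : Real.exp 1 * (D * ‖w σ‖ * Z) ≤ Real.exp 1 * (D * δ * Z) := by
    have := hδ σ
    gcongr
  rw [hlogm] at hlog
  linarith

open NumberField InfinitePlace mixedEmbedding MeasureTheory nonZeroDivisors in
/-- Every fractional ideal `I` contains an element `g` generating `I * A` with `A` of bounded norm,
all of whose conjugates have size comparable with the normalized norm of `I`. -/
theorem NumberField.exists_spanSingleton_eq_mul (K : Type*) [Field K] [NumberField K] :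
    ∃ C : ℕ, ∀ I : FractionalIdeal (𝓞 K)⁰ K, I ≠ 0 → ∃ (g : K) (A : Ideal (𝓞 K)), g ≠ 0 ∧
      Ideal.absNorm A ≤ C ∧ FractionalIdeal.spanSingleton (𝓞 K)⁰ g = I * A ∧
      ∀ σ : K →+* ℂ, |Real.log ‖σ g‖| ≤ |Real.log (FractionalIdeal.absNorm I)| + C := by
  classical
  set d := Module.finrank ℚ K with hd
  have hdpos : 0 < d := Module.finrank_pos
  set V : ENNReal := volume (ZSpan.fundamentalDomain (latticeBasis K)) *
    2 ^ (Module.finrank ℝ (mixedSpace K)) with hV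
  have hVtop : V ≠ ⊤ := (ENNReal.mul_lt_top
    (ZSpan.fundamentalDomain_isBounded _).measure_lt_top
    (ENNReal.pow_lt_top ENNReal.ofNat_lt_top)).ne
  set C₁ : NNReal := V.toNNReal + 1 with hC₁
  have hC₁1 : 1 ≤ C₁ := le_add_of_nonneg_left zero_le
  have hVC : V < (C₁ ^ d : NNReal) := by
    rw [← ENNReal.coe_toNNReal hVtop, ENNReal.coe_lt_coe]
    calc V.toNNReal < C₁ := lt_add_one _
      _ ≤ C₁ ^ d := le_self_pow₀ hC₁1 hdpos.ne'
  obtain ⟨C, hC⟩ := exists_nat_ge (max ((C₁ : ℝ) ^ d) ((d + 1) * Real.log C₁))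
  refine ⟨C, fun I hI => ?_⟩
  set n : ℝ := (FractionalIdeal.absNorm I : ℝ) with hn
  have hn0 : 0 < n := by
    have h1 := FractionalIdeal.absNorm_nonneg I
    have h2 : FractionalIdeal.absNorm I ≠ 0 := by
      rwa [Ne, FractionalIdeal.absNorm_eq_zero_iff]
    rw [hn]
    exact_mod_cast lt_of_le_of_ne h1 h2.symm
  set n' : NNReal := ⟨n, hn0.le⟩ with hn'
  set f : NNReal := C₁ * n' ^ (1 / d : ℝ) with hf
  have hfd : f ^ d = C₁ ^ d * n' := by
    rw [hf, mul_pow, ← NNReal.rpow_natCast (n' ^ _), ← NNReal.rpow_mul, one_div,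
      inv_mul_cancel₀ (by positivity), NNReal.rpow_one]
  have hn'0 : 0 < n' := hn0
  have hf0 : 0 < f := by positivity
  have hprodf : ∏ w : InfinitePlace K, f ^ w.mult = f ^ d := by
    rw [Finset.prod_pow_eq_pow_sum, sum_mult_eq]
  have hmink : minkowskiBound K (Units.mk0 I hI) < volume (convexBodyLT K fun _ => f) := by
    rw [convexBodyLT_volume, minkowskiBound,
      volume_fundamentalDomain_fractionalIdealLatticeBasis, mul_assoc, ← hV]
    calc ENNReal.ofReal (FractionalIdeal.absNorm (Units.mk0 I hI).1) * V
        < ENNReal.ofReal n * (C₁ ^ d : NNReal) := by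
          rw [Units.val_mk0]
          refine ENNReal.mul_lt_mul_right ?_ ENNReal.ofReal_ne_top hVC
          exact (ENNReal.ofReal_pos.2 hn0).ne'
      _ = (f ^ d : NNReal) := by
          rw [hfd, ENNReal.coe_mul, mul_comm]
          congr 1
          exact ENNReal.ofReal_eq_coe_nnreal hn0.le
      _ ≤ _ := by
          rw [← hprodf, ENNReal.ofNNReal_finsetProd]
          simp only [ENNReal.coe_pow]
          refine le_mul_of_one_le_left zero_le ?_
          exact_mod_cast one_le_convexBodyLTFactor K
  obtain ⟨g, hgI, hg0, hgf⟩ := exists_ne_zero_mem_ideal_lt K (Units.mk0 I hI) hmink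
  rw [Units.val_mk0] at hgI
  have hle : FractionalIdeal.spanSingleton (𝓞 K)⁰ g * I⁻¹ ≤ 1 := by
    rw [← mul_inv_cancel₀ hI]
    exact mul_le_mul_left (FractionalIdeal.spanSingleton_le_iff_mem.2 hgI) _
  obtain ⟨A, hA⟩ := FractionalIdeal.le_one_iff_exists_coeIdeal.1 hle
  have hgA : FractionalIdeal.spanSingleton (𝓞 K)⁰ g = I * A := by
    rw [hA, mul_comm, mul_assoc, inv_mul_cancel₀ hI, mul_one]
  have hnorm : |(Algebra.norm ℚ g : ℝ)| = n * Ideal.absNorm A := by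
    have h1 := congrArg FractionalIdeal.absNorm hgA
    rw [map_mul, FractionalIdeal.absNorm_span_singleton, FractionalIdeal.coeIdeal_absNorm] at h1
    rw [hn]
    exact_mod_cast h1
  have hprodle : ∏ w : InfinitePlace K, w g ^ w.mult = n * Ideal.absNorm A := by
    rw [prod_eq_abs_norm, ← hnorm]
    simp
  have hA1 : 1 ≤ Ideal.absNorm A := by
    by_contra! h
    have h2 : Ideal.absNorm A = 0 := by omega
    rw [h2, Nat.cast_zero, mul_zero, Finset.prod_eq_zero_iff] at hprodle
    obtain ⟨w, _, hw⟩ := hprodle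
    exact hg0 ((map_eq_zero w).1 (pow_eq_zero_iff (mult_ne_zero) |>.1 hw))
  have hratio : ∏ w : InfinitePlace K, (w g / f) ^ w.mult = Ideal.absNorm A / (C₁ : ℝ) ^ d := by
    have h1 : ∏ w : InfinitePlace K, (f : ℝ) ^ w.mult = (C₁ : ℝ) ^ d * n := by
      have := congrArg ((↑) : NNReal → ℝ) (hprodf.trans hfd)
      push_cast at this
      exact this
    simp only [div_pow]
    rw [Finset.prod_div_distrib, h1, hprodle]
    have : (C₁ : ℝ) ≠ 0 := by positivity
    field_simp
  have hw1 : ∀ w : InfinitePlace K, w g / f ≤ 1 := fun w => by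
    rw [div_le_one (by exact_mod_cast hf0)]
    exact (hgf w).le
  have hw0 : ∀ w : InfinitePlace K, 0 ≤ w g / f := fun w => by positivity
  have hC₁R : (1 : ℝ) ≤ C₁ := by exact_mod_cast hC₁1
  have hAC : (Ideal.absNorm A : ℝ) ≤ (C₁ : ℝ) ^ d := by
    have h1 : ∏ w : InfinitePlace K, (w g / f) ^ w.mult ≤ 1 :=
      Finset.prod_le_one (fun w _ => pow_nonneg (hw0 w) _) fun w _ => pow_le_one₀ (hw0 w) (hw1 w)
    rwa [hratio, div_le_one (by positivity)] at h1
  refine ⟨g, A, hg0, ?_, hgA, fun σ => ?_⟩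
  · exact_mod_cast hAC.trans ((le_max_left _ _).trans hC)
  · set w := InfinitePlace.mk σ with hw
    have hwσ : ‖σ g‖ = w g := by rw [hw, InfinitePlace.apply]
    have hlow : 1 / (C₁ : ℝ) ^ d ≤ w g / f := by
      calc 1 / (C₁ : ℝ) ^ d ≤ Ideal.absNorm A / (C₁ : ℝ) ^ d := by
            have : (1 : ℝ) ≤ Ideal.absNorm A := by exact_mod_cast hA1
            gcongr
        _ = ∏ w : InfinitePlace K, (w g / f) ^ w.mult := hratio.symm
        _ = (w g / f) ^ w.mult * ∏ w' ∈ Finset.univ.erase w, (w' g / f) ^ w'.mult :=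
            (Finset.mul_prod_erase _ (fun w' : InfinitePlace K => (w' g / f) ^ w'.mult)
              (Finset.mem_univ w)).symm
        _ ≤ (w g / f) * 1 := by
            refine mul_le_mul (pow_le_of_le_one (hw0 w) (hw1 w) mult_ne_zero)
              (Finset.prod_le_one (fun w _ => pow_nonneg (hw0 w) _) fun w _ =>
              pow_le_one₀ (hw0 w) (hw1 w)) (Finset.prod_nonneg fun w _ => pow_nonneg (hw0 w) _)
              (hw0 w)
        _ = _ := mul_one _
    have hwg0 : 0 < w g := by
      rw [← hwσ]
      exact norm_pos_iff.2 (by simpa using hg0)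
    have hfR : (0 : ℝ) < f := by exact_mod_cast hf0
    have hloglow : -(d * Real.log C₁) ≤ Real.log (w g) - Real.log f := by
      have := Real.log_le_log (by positivity) hlow
      rwa [Real.log_div one_ne_zero (by positivity), Real.log_one, zero_sub, Real.log_pow,
        Real.log_div hwg0.ne' hfR.ne'] at this
    have hlogup : Real.log (w g) ≤ Real.log f := Real.log_le_log hwg0 (hgf w).le
    have hlogf : Real.log f = Real.log C₁ + 1 / d * Real.log n := by
      rw [hf]
      push_cast
      rw [Real.log_mul (by positivity) (by positivity), Real.log_rpow (by positivity)]
      rfl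
    have hdn : |1 / (d : ℝ) * Real.log n| ≤ |Real.log n| := by
      rw [abs_mul]
      refine mul_le_of_le_one_left (abs_nonneg _) ?_
      rw [abs_of_nonneg (by positivity), div_le_one (by positivity)]
      exact_mod_cast hdpos
    have hlogC : 0 ≤ Real.log C₁ := Real.log_nonneg hC₁R
    have hCC := (le_max_right _ _).trans hC
    have hdl : 0 ≤ d * Real.log C₁ := by positivity
    rw [hwσ, abs_le]
    rw [abs_le] at hdn
    constructor <;> nlinarith

open NumberField IsDedekindDomain nonZeroDivisors in
/-- The fractional ideal `∏ v ∈ T, v ^ c v`. -/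
noncomputable def NumberField.idealProd {K : Type*} [Field K] [NumberField K]
    (T : Finset (HeightOneSpectrum (𝓞 K))) (c : HeightOneSpectrum (𝓞 K) → ℤ) :
    FractionalIdeal (𝓞 K)⁰ K :=
  ∏ v ∈ T, (v.asIdeal : FractionalIdeal (𝓞 K)⁰ K) ^ c v

namespace NumberField

open IsDedekindDomain nonZeroDivisors

variable {K : Type*} [Field K] [NumberField K] (T : Finset (HeightOneSpectrum (𝓞 K)))
  (b c : HeightOneSpectrum (𝓞 K) → ℤ)

theorem coeIdeal_prod (f : HeightOneSpectrum (𝓞 K) → Ideal (𝓞 K)) :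
    ((∏ v ∈ T, f v : Ideal (𝓞 K)) : FractionalIdeal (𝓞 K)⁰ K) =
      ∏ v ∈ T, (f v : FractionalIdeal _ K) :=
  map_prod (FractionalIdeal.coeIdealHom (𝓞 K)⁰ K) _ _

theorem coeIdeal_asIdeal_ne_zero (v : HeightOneSpectrum (𝓞 K)) :
    (v.asIdeal : FractionalIdeal (𝓞 K)⁰ K) ≠ 0 :=
  FractionalIdeal.coeIdeal_ne_zero.2 v.ne_bot

theorem idealProd_ne_zero : idealProd T c ≠ 0 :=
  Finset.prod_ne_zero_iff.2 fun v _ => zpow_ne_zero _ (coeIdeal_asIdeal_ne_zero v)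

theorem idealProd_add : idealProd T (b + c) = idealProd T b * idealProd T c := by
  rw [idealProd, idealProd, idealProd, ← Finset.prod_mul_distrib]
  exact Finset.prod_congr rfl fun v _ => zpow_add₀ (coeIdeal_asIdeal_ne_zero v) _ _

theorem idealProd_sub : idealProd T (b - c) = idealProd T b * (idealProd T c)⁻¹ := by
  rw [eq_mul_inv_iff_mul_eq₀ (idealProd_ne_zero T c), ← idealProd_add, sub_add_cancel]

theorem idealProd_nsmul (n : ℕ) : idealProd T (n • c) = idealProd T c ^ n := by
  induction n with
  | zero => simp [idealProd]
  | succ n ih => rw [succ_nsmul, idealProd_add, ih, pow_succ]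

theorem count_idealProd {v : HeightOneSpectrum (𝓞 K)} (hv : v ∈ T) :
    FractionalIdeal.count K v (idealProd T c) = c v := by
  have h := FractionalIdeal.count_prod K v T
    (fun w => (w.asIdeal : FractionalIdeal (𝓞 K)⁰ K) ^ c w) fun w _ =>
    zpow_ne_zero _ (coeIdeal_asIdeal_ne_zero w)
  rw [idealProd, h, Finset.sum_eq_single v]
  · rw [FractionalIdeal.count_zpow_self]
  · intro w _ hw
    rw [FractionalIdeal.count_zpow, FractionalIdeal.count_maximal_coprime K v hw, mul_zero]
  · exact fun h => absurd hv h

theorem idealProd_le_one (hc : ∀ v ∈ T, 0 ≤ c v) : idealProd T c ≤ 1 := by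
  refine FractionalIdeal.le_one_iff_exists_coeIdeal.2
    ⟨∏ v ∈ T, v.asIdeal ^ (c v).toNat, ?_⟩
  rw [coeIdeal_prod, idealProd]
  refine Finset.prod_congr rfl fun v hv => ?_
  rw [FractionalIdeal.coeIdeal_pow, ← zpow_natCast, Int.toNat_of_nonneg (hc v hv)]

theorem absNorm_asIdeal_pos (v : HeightOneSpectrum (𝓞 K)) : 0 < Ideal.absNorm v.asIdeal :=
  Nat.pos_of_ne_zero (Ideal.absNorm_eq_zero_iff.not.2 v.ne_bot)

theorem log_absNorm_asIdeal_nonneg (v : HeightOneSpectrum (𝓞 K)) :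
    0 ≤ Real.log (Ideal.absNorm v.asIdeal) :=
  Real.log_natCast_nonneg _

theorem log_absNorm_idealProd : Real.log (FractionalIdeal.absNorm (idealProd T c)) =
    ∑ v ∈ T, c v * Real.log (Ideal.absNorm v.asIdeal) := by
  rw [idealProd, map_prod]
  push_cast
  rw [Real.log_prod]
  · refine Finset.sum_congr rfl fun v _ => ?_
    rw [map_zpow₀, FractionalIdeal.coeIdeal_absNorm]
    push_cast
    rw [Real.log_zpow]
  · intro v _
    rw [map_zpow₀, FractionalIdeal.coeIdeal_absNorm]
    have := absNorm_asIdeal_pos v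
    positivity

theorem isIntegral_prod_absNorm_mul {x : K} (hx : x ∈ idealProd T c) :
    IsIntegral ℤ (((∏ v ∈ T, Ideal.absNorm v.asIdeal ^ (c v).natAbs : ℕ) : K) * x) := by
  have h1 : ((∏ v ∈ T, Ideal.absNorm v.asIdeal ^ (c v).natAbs : ℕ) : K) ∈
      idealProd T fun v => ((c v).natAbs : ℤ) := by
    have h2 : idealProd T (fun v => ((c v).natAbs : ℤ)) =
        ((∏ v ∈ T, v.asIdeal ^ (c v).natAbs : Ideal (𝓞 K)) : FractionalIdeal (𝓞 K)⁰ K) := by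
      rw [coeIdeal_prod, idealProd]
      refine Finset.prod_congr rfl fun v _ => ?_
      rw [FractionalIdeal.coeIdeal_pow, zpow_natCast]
    rw [h2, FractionalIdeal.mem_coeIdeal]
    refine ⟨((∏ v ∈ T, Ideal.absNorm v.asIdeal ^ (c v).natAbs : ℕ) : 𝓞 K), ?_, by simp⟩
    push_cast
    exact Ideal.prod_mem_prod fun v _ => Ideal.pow_mem_pow (Ideal.absNorm_mem _) _
  have h3 := FractionalIdeal.mul_mem_mul h1 hx
  rw [← idealProd_add] at h3
  have h4 := idealProd_le_one T _ (fun v _ => ?_) h3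
  · obtain ⟨y, hy⟩ := (FractionalIdeal.mem_one_iff _).1 h4
    rw [← hy]
    exact y.2
  · simp only [Pi.add_apply]
    have := neg_le_abs (c v)
    rw [Int.natCast_natAbs]
    linarith

theorem log_prod_absNorm_pow_le {X lam : ℝ} (hc : ∀ v ∈ T, |(c v : ℝ)| ≤ X)
    (hlam : ∑ v ∈ T, Real.log (Ideal.absNorm v.asIdeal) ≤ lam) (hX : 0 ≤ X) :
    Real.log ((∏ v ∈ T, Ideal.absNorm v.asIdeal ^ (c v).natAbs : ℕ)) ≤ X * lam := by
  push_cast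
  rw [Real.log_prod]
  · refine le_trans ?_ (mul_le_mul_of_nonneg_left hlam hX)
    rw [Finset.mul_sum]
    refine Finset.sum_le_sum fun v hv => ?_
    rw [Real.log_pow, Nat.cast_natAbs, Int.cast_abs]
    exact mul_le_mul_of_nonneg_right (hc v hv) (log_absNorm_asIdeal_nonneg v)
  · intro v _
    have := absNorm_asIdeal_pos v
    positivity

theorem abs_log_absNorm_spanSingleton_le {u : K} (hu : u ≠ 0) {X : ℝ}
    (hX : ∀ σ : K →+* ℂ, |Real.log ‖σ u‖| ≤ X) :
    |Real.log (FractionalIdeal.absNorm (FractionalIdeal.spanSingleton (𝓞 K)⁰ u))| ≤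
      Module.finrank ℚ K * X := by
  have h1 : (FractionalIdeal.absNorm (FractionalIdeal.spanSingleton (𝓞 K)⁰ u) : ℝ) =
      ∏ w : InfinitePlace K, w u ^ w.mult := by
    rw [InfinitePlace.prod_eq_abs_norm, FractionalIdeal.absNorm_span_singleton]
  rw [h1, Real.log_prod]
  · refine (Finset.abs_sum_le_sum_abs _ _).trans ?_
    rw [← InfinitePlace.sum_mult_eq]
    push_cast
    rw [Finset.sum_mul]
    refine Finset.sum_le_sum fun w _ => ?_
    rw [Real.log_pow, abs_mul, Nat.abs_cast, ← InfinitePlace.norm_embedding_eq]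
    exact mul_le_mul_of_nonneg_left (hX _) (Nat.cast_nonneg _)
  · intro w _
    exact pow_ne_zero _ ((map_ne_zero w).2 hu)

end NumberField

theorem Int.floor_mul_eq_imp_abs_sub_le {Q : ℕ} (hQ : 0 < Q) {x y : ℝ}
    (h : ⌊(Q : ℝ) * x⌋ = ⌊(Q : ℝ) * y⌋) : |x - y| ≤ 1 / Q := by
  have h1 := Int.abs_sub_lt_one_of_floor_eq_floor h
  have hQ' : (0 : ℝ) < Q := by exact_mod_cast hQ
  rw [← mul_sub, abs_mul, abs_of_pos hQ'] at h1
  rw [le_div_iff₀ hQ']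
  linarith

namespace NumberField

open IsDedekindDomain nonZeroDivisors

variable {K : Type*} [Field K] [NumberField K]

/-- The exponent of the approximation to the `j / M`-th power of an ideal. -/
noncomputable def approxExponent (M : ℕ) (L : Finset (HeightOneSpectrum (𝓞 K)))
    (b : HeightOneSpectrum (𝓞 K) → ℤ) (j : ℕ) (v : HeightOneSpectrum (𝓞 K)) : ℤ :=
  open Classical in if v ∈ L then ⌊(j : ℝ) * b v / M⌋ else 0

/-- If the ideal of `u` is close to a perfect power in the sense that few of its exponents are
large, there is an element `η` that is close to `1` at all places and approximates `u ^ (q / M)`. -/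
theorem exists_approx_root (K : Type*) [Field K] [NumberField K] : ∃ C : ℕ,
    ∀ (T : Finset (HeightOneSpectrum (𝓞 K))) (b : HeightOneSpectrum (𝓞 K) → ℤ) (u : K)
    (M J Q lam : ℕ), u ≠ 0 → FractionalIdeal.spanSingleton (𝓞 K)⁰ u = idealProd T b →
    (∀ σ : K →+* ℂ, |Real.log ‖σ u‖| ≤ 1) → 0 < M → J ≤ M → 0 < Q → 0 < lam →
    ∑ v ∈ T, Real.log (Ideal.absNorm v.asIdeal) ≤ lam →
    Q ^ (T.filter fun v => M ≤ (b v).natAbs * (J * Q)).card * (C * (Q * lam)) ^ C < J + 1 →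
    ∃ (q : ℕ) (η : K) (m : HeightOneSpectrum (𝓞 K) → ℤ), 0 < q ∧ q ≤ J ∧ η ≠ 0 ∧
      FractionalIdeal.spanSingleton (𝓞 K)⁰ η = idealProd T m ∧
      (∀ v ∈ T, |(m v : ℝ) * M - q * b v| * Q ≤ M) ∧
      ∀ σ : K →+* ℂ, ∃ w : ℂ, Complex.exp w = σ η ∧ ‖w‖ ≤ 2 / Q := by
  classical
  obtain ⟨B, hB⟩ := exists_spanSingleton_eq_mul K
  have hfin : {A : Ideal (𝓞 K) | Ideal.absNorm A ≤ B}.Finite := Ideal.finite_setOfPred_absNorm_le B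
  set 𝒜 : Finset (Ideal (𝓞 K)) := hfin.toFinset with h𝒜
  set d := Module.finrank ℚ K with hd
  set h := 𝒜.card with hh
  refine ⟨h + 3 * (d + B + 5) + 2 * d + 1, ?_⟩
  set C := h + 3 * (d + B + 5) + 2 * d + 1 with hC
  intro T b u M J Q lam hu hub hσu hM hJM hQ hlam hsum hcount
  set L := T.filter fun v => M ≤ (b v).natAbs * (J * Q) with hL
  have hMR : (0 : ℝ) < M := by exact_mod_cast hM
  have hQR : (0 : ℝ) < Q := by exact_mod_cast hQ
  set c := approxExponent M L b with hc
  choose g A hg0 hAB hgA hgσ using fun j => hB (idealProd T (c j)) (idealProd_ne_zero T (c j))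
  set R := lam + d + B + 4 with hR
  have hlogI : ∀ j ≤ J, |Real.log (FractionalIdeal.absNorm (idealProd T (c j)))| ≤ lam + d := by
    intro j hj
    have hjR : (j : ℝ) ≤ J := by exact_mod_cast hj
    have hJMR : (J : ℝ) ≤ M := by exact_mod_cast hJM
    have hQ1 : (1 : ℝ) ≤ Q := by exact_mod_cast hQ
    have herr : ∀ v ∈ T, |(c j v : ℝ) - (j : ℝ) * b v / M| ≤ 1 := by
      intro v hv
      by_cases hvL : v ∈ L
      · simp only [hc, approxExponent, hvL, if_true]
        rw [abs_sub_comm, Int.self_sub_floor, abs_of_nonneg (Int.fract_nonneg _)]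
        exact (Int.fract_lt_one _).le
      · have h1 : (b v).natAbs * (J * Q) < M := by
          by_contra! h1
          exact hvL (Finset.mem_filter.2 ⟨hv, h1⟩)
        have h2 : |(b v : ℝ)| * (J * Q) ≤ M := by
          have h3 : (((b v).natAbs * (J * Q) : ℕ) : ℝ) ≤ M := by exact_mod_cast h1.le
          push_cast at h3
          rwa [Nat.cast_natAbs, Int.cast_abs] at h3
        simp only [hc, approxExponent, hvL, if_false]
        rw [Int.cast_zero, zero_sub, abs_neg, abs_div, abs_mul, Nat.abs_cast, Nat.abs_cast,
          div_le_one hMR]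
        calc (j : ℝ) * |(b v : ℝ)| ≤ J * |(b v : ℝ)| * Q := by
              nlinarith [mul_le_mul_of_nonneg_right hjR (abs_nonneg (b v : ℝ)),
                mul_nonneg (Nat.cast_nonneg J : (0 : ℝ) ≤ J) (abs_nonneg (b v : ℝ))]
          _ = |(b v : ℝ)| * (J * Q) := by ring
          _ ≤ M := h2
    have hu1 := abs_log_absNorm_spanSingleton_le hu hσu
    rw [hub, log_absNorm_idealProd, ← hd, mul_one] at hu1
    rw [log_absNorm_idealProd]
    have hsplit : ∑ v ∈ T, (c j v : ℝ) * Real.log (Ideal.absNorm v.asIdeal) =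
        ∑ v ∈ T, ((c j v : ℝ) - (j : ℝ) * b v / M) * Real.log (Ideal.absNorm v.asIdeal) +
          (j / M : ℝ) * ∑ v ∈ T, (b v : ℝ) * Real.log (Ideal.absNorm v.asIdeal) := by
      rw [Finset.mul_sum, ← Finset.sum_add_distrib]
      exact Finset.sum_congr rfl fun v _ => by ring
    rw [hsplit]
    refine (abs_add_le _ _).trans (add_le_add ?_ ?_)
    · refine (Finset.abs_sum_le_sum_abs _ _).trans (le_trans ?_ hsum)
      refine Finset.sum_le_sum fun v hv => ?_
      rw [abs_mul, abs_of_nonneg (log_absNorm_asIdeal_nonneg v)]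
      exact mul_le_of_le_one_left (log_absNorm_asIdeal_nonneg v) (herr v hv)
    · rw [abs_mul, abs_of_nonneg (by positivity : (0 : ℝ) ≤ j / M)]
      refine le_trans (mul_le_of_le_one_left (abs_nonneg _) ?_) hu1
      rw [div_le_one hMR]
      exact hjR.trans hJMR
  have hre : ∀ j ≤ J, ∀ σ : K →+* ℂ, |(Complex.log (σ (g j))).re| ≤ R := by
    intro j hj σ
    rw [Complex.log_re]
    refine (hgσ j σ).trans ?_
    have := hlogI j hj
    rw [hR]
    push_cast
    linarith
  have him : ∀ j, ∀ σ : K →+* ℂ, |(Complex.log (σ (g j))).im| ≤ R := by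
    intro j σ
    rw [Complex.log_im]
    refine (Complex.abs_arg_le_pi _).trans (Real.pi_le_four.trans ?_)
    rw [hR]
    push_cast
    linarith [(Nat.cast_nonneg lam : (0:ℝ) ≤ lam), (Nat.cast_nonneg d : (0:ℝ) ≤ d),
      (Nat.cast_nonneg B : (0:ℝ) ≤ B)]
  set box : Finset ℤ := Finset.Icc (-((Q * R : ℕ) : ℤ)) ((Q * R : ℕ) : ℤ) with hbox
  have hmem : ∀ x : ℝ, |x| ≤ R → ⌊(Q : ℝ) * x⌋ ∈ box := by
    intro x hx
    rw [abs_le] at hx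
    rw [hbox, Finset.mem_Icc, Int.le_floor]
    constructor
    · push_cast
      nlinarith
    · have : ⌊(Q : ℝ) * x⌋ ≤ ⌊((Q * R : ℕ) : ℝ)⌋ := by
        apply Int.floor_le_floor
        push_cast
        nlinarith
      rwa [Int.floor_natCast] at this
  set target : Finset ((L → ℤ) × ((K →+* ℂ) → ℤ × ℤ) × Ideal (𝓞 K)) :=
    (Fintype.piFinset fun _ : L => Finset.Ico (0 : ℤ) Q) ×ˢ
      (Fintype.piFinset fun _ : K →+* ℂ => box ×ˢ box) ×ˢ 𝒜 with htarget
  let F : ℕ → (L → ℤ) × ((K →+* ℂ) → ℤ × ℤ) × Ideal (𝓞 K) := fun j =>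
    (fun v => ⌊(Q : ℝ) * Int.fract ((j : ℝ) * b v / M)⌋,
      fun σ => (⌊(Q : ℝ) * (Complex.log (σ (g j))).re⌋, ⌊(Q : ℝ) * (Complex.log (σ (g j))).im⌋),
      A j)
  have hF : ∀ j ∈ Finset.range (J + 1), F j ∈ target := by
    intro j hj
    have hjJ : j ≤ J := Nat.lt_succ_iff.1 (Finset.mem_range.1 hj)
    simp only [F, htarget, Finset.mem_product, Fintype.mem_piFinset]
    refine ⟨fun v => ?_, fun σ => ⟨hmem _ (hre j hjJ σ), hmem _ (him j σ)⟩, ?_⟩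
    · have h0 := Int.fract_nonneg ((j : ℝ) * b v / M)
      have h1 := Int.fract_lt_one ((j : ℝ) * b v / M)
      rw [Finset.mem_Ico, Int.floor_lt]
      refine ⟨Int.floor_nonneg.2 (by positivity), ?_⟩
      push_cast
      nlinarith
    · rw [h𝒜, Set.Finite.mem_toFinset]
      exact hAB j
  have hcard : target.card < (Finset.range (J + 1)).card := by
    rw [Finset.card_range]
    refine lt_of_le_of_lt ?_ hcount
    rw [htarget, Finset.card_product, Finset.card_product, Fintype.card_piFinset,
      Fintype.card_piFinset, Finset.prod_const, Finset.prod_const, Finset.card_product,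
      Int.card_Ico, Finset.card_univ, Finset.card_univ, Embeddings.card, ← hd, Fintype.card_coe,
      hbox, Int.card_Icc, ← hh]
    have e1 : ((Q : ℤ) - 0).toNat = Q := by simp
    have e2 : (((Q * R : ℕ) : ℤ) + 1 - -((Q * R : ℕ) : ℤ)).toNat = 2 * (Q * R) + 1 := by omega
    rw [e1, e2]
    refine Nat.mul_le_mul_left _ ?_
    have hQl : 1 ≤ Q * lam := Nat.mul_pos hQ hlam
    have hR' : R ≤ lam * (d + B + 5) := by
      rw [hR]
      nlinarith
    have e3 : 2 * (Q * R) + 1 ≤ C * (Q * lam) := by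
      have e4 : Q * R ≤ (Q * lam) * (d + B + 5) := by
        rw [mul_assoc]
        exact Nat.mul_le_mul_left _ hR'
      have e5 : 1 ≤ (Q * lam) * (d + B + 5) := Nat.mul_pos hQl (by omega)
      have e6 : 3 * (d + B + 5) ≤ C := by omega
      nlinarith
    have e7 : h ≤ C * (Q * lam) := by
      have : h ≤ C := by omega
      nlinarith
    have e8 : 1 ≤ C * (Q * lam) := Nat.mul_pos (by omega) hQl
    calc ((2 * (Q * R) + 1) * (2 * (Q * R) + 1)) ^ d * h
        ≤ ((C * (Q * lam)) * (C * (Q * lam))) ^ d * (C * (Q * lam)) := by gcongr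
      _ = (C * (Q * lam)) ^ (2 * d + 1) := by rw [← sq, ← pow_mul, ← pow_succ]
      _ ≤ (C * (Q * lam)) ^ C := Nat.pow_le_pow_right e8 (by omega)
  obtain ⟨j₁, hj₁, j₂, hj₂, hne, hFeq⟩ :=
    Finset.exists_ne_map_eq_of_card_lt_of_maps_to hcard hF
  wlog hlt : j₁ < j₂ generalizing j₁ j₂
  · exact this j₂ hj₂ j₁ hj₁ hne.symm hFeq.symm (lt_of_le_of_ne (not_lt.1 hlt) hne.symm)
  obtain ⟨q, hq⟩ := Nat.exists_eq_add_of_le hlt.le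
  have hj₂J : j₂ ≤ J := Nat.lt_succ_iff.1 (Finset.mem_range.1 hj₂)
  simp only [F, Prod.mk.injEq] at hFeq
  obtain ⟨hF1, hF2, hF3⟩ := hFeq
  have hspan : ∀ x : K, x ≠ 0 → FractionalIdeal.spanSingleton (𝓞 K)⁰ x ≠ 0 := fun x hx =>
    FractionalIdeal.spanSingleton_ne_zero_iff.2 hx
  refine ⟨q, g j₂ * (g j₁)⁻¹, c j₂ - c j₁, by omega, by omega,
    mul_ne_zero (hg0 _) (inv_ne_zero (hg0 _)), ?_, ?_, ?_⟩
  · have hA0 : (A j₁ : FractionalIdeal (𝓞 K)⁰ K) ≠ 0 := by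
      intro h0
      apply hspan _ (hg0 j₁)
      rw [hgA, h0, mul_zero]
    rw [← FractionalIdeal.spanSingleton_mul_spanSingleton, ← FractionalIdeal.spanSingleton_inv,
      hgA, hgA, idealProd_sub, ← hF3, mul_inv]
    have h1 : (A j₁ : FractionalIdeal (𝓞 K)⁰ K) * (A j₁ : FractionalIdeal (𝓞 K)⁰ K)⁻¹ = 1 :=
      mul_inv_cancel₀ hA0
    calc _ = idealProd T (c j₂) * (idealProd T (c j₁))⁻¹ *
          ((A j₁ : FractionalIdeal (𝓞 K)⁰ K) * (A j₁ : FractionalIdeal (𝓞 K)⁰ K)⁻¹) := by ac_rfl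
      _ = _ := by rw [h1, mul_one]
  · intro v hv
    have hq' : (q : ℝ) = j₂ - j₁ := by
      rw [hq]
      push_cast
      ring
    by_cases hvL : v ∈ L
    · have h1 := congrFun hF1 ⟨v, hvL⟩
      have h2 := Int.floor_mul_eq_imp_abs_sub_le hQ h1
      simp only [Pi.sub_apply, hc, approxExponent, hvL, if_true]
      rw [← Int.self_sub_floor, ← Int.self_sub_floor] at h2
      rw [le_div_iff₀ hQR] at h2
      have h3 : ((⌊(j₂ : ℝ) * b v / M⌋ - ⌊(j₁ : ℝ) * b v / M⌋ : ℤ) : ℝ) * M - q * b v =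
          ((j₁ : ℝ) * b v / M - ⌊(j₁ : ℝ) * b v / M⌋ - ((j₂ : ℝ) * b v / M -
            ⌊(j₂ : ℝ) * b v / M⌋)) * M := by
        rw [hq']
        push_cast
        field_simp
        ring
      rw [h3, abs_mul, abs_of_pos hMR]
      nlinarith
    · have h1 : (b v).natAbs * (J * Q) < M := by
        by_contra! h1
        exact hvL (Finset.mem_filter.2 ⟨hv, h1⟩)
      simp only [Pi.sub_apply, hc, approxExponent, hvL, if_false]
      have h2 : |(b v : ℝ)| * (J * Q) ≤ M := by
        have h3 : (((b v).natAbs * (J * Q) : ℕ) : ℝ) ≤ M := by exact_mod_cast h1.le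
        push_cast at h3
        rwa [Nat.cast_natAbs, Int.cast_abs] at h3
      have h4 : (q : ℝ) ≤ J := by exact_mod_cast (by omega : q ≤ J)
      have h5 : |((0 - 0 : ℤ) : ℝ) * M - q * b v| = q * |(b v : ℝ)| := by
        simp [abs_mul]
      rw [h5]
      calc (q : ℝ) * |(b v : ℝ)| * Q ≤ J * |(b v : ℝ)| * Q := by gcongr
        _ = |(b v : ℝ)| * (J * Q) := by ring
        _ ≤ M := h2
  · intro σ
    refine ⟨Complex.log (σ (g j₂)) - Complex.log (σ (g j₁)), ?_, ?_⟩
    · have hne' : ∀ j, σ (g j) ≠ 0 := fun j => (map_ne_zero σ).2 (hg0 j)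
      rw [Complex.exp_sub, Complex.exp_log (hne' _), Complex.exp_log (hne' _), map_mul, map_inv₀,
        div_eq_mul_inv]
    · have h1 := congrFun hF2 σ
      simp only [Prod.mk.injEq] at h1
      have h2 := Int.floor_mul_eq_imp_abs_sub_le hQ h1.1
      have h3 := Int.floor_mul_eq_imp_abs_sub_le hQ h1.2
      refine (Complex.norm_le_abs_re_add_abs_im _).trans ?_
      rw [Complex.sub_re, Complex.sub_im, abs_sub_comm, abs_sub_comm (Complex.im _)]
      calc _ ≤ 1 / (Q : ℝ) + 1 / Q := add_le_add h2 h3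
        _ = 2 / Q := by ring

end NumberField

theorem Real.numeric_bound_of_large {N : ℝ} (hN : 10 ^ 5 ≤ N) :
    N / 20 + N / 120 + 2 * Real.log (N + 1) + Real.log 2 + N / 20 + N / 20 < (N - 1) / 2 := by
  have h1 : Real.log (N + 1) ≤ (N + 1) / 100 + 99 := by
    have h2 : N + 1 = 100 * ((N + 1) / 100) := by ring
    rw [h2, Real.log_mul (by norm_num) (by positivity), ← h2]
    have h3 := Real.log_le_sub_one_of_pos (by positivity : 0 < (N + 1) / 100)
    have h4 := Real.log_le_sub_one_of_pos (by norm_num : (0 : ℝ) < 100)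
    linarith
  have h5 := Real.log_le_sub_one_of_pos (by norm_num : (0 : ℝ) < 2)
  linarith

theorem Real.abs_log_le_one_of_abs_sub_one_le {x : ℝ} (hx : |x - 1| ≤ 1 / 2) :
    |Real.log x| ≤ 1 := by
  rw [abs_le] at hx ⊢
  have hx0 : 0 < x := by linarith
  constructor
  · have h1 := Real.one_sub_inv_le_log_of_pos hx0
    have h2 : x⁻¹ ≤ 2 := by
      rw [inv_le_comm₀ hx0 (by norm_num)]
      linarith
    linarith
  · have := Real.log_le_sub_one_of_pos hx0
    linarith

/-- Bounds for the parameters of the auxiliary determinant. -/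
theorem Nat.exists_determinant_parameters {M Q D lam q : ℕ} (hq : 0 < q) (hD : 20 ≤ D)
    (hlam : 1 ≤ lam) (hqQ : q ^ 2 * Q ≤ M) (hQ : 964 * D * lam ≤ Q) :
    ∃ S S' K₀ : ℕ, 0 < K₀ ∧ 0 < S' ∧ S ≤ M / q ∧ D * K₀ ≤ (S + 1 - D) * S' ∧
      (S * (q * lam) : ℝ) * D ≤ (K₀ * D) / 20 ∧
      (S' * (2 * M / (q * Q) * lam) : ℝ) * D ≤ (K₀ * D) / 120 ∧
      (S + (M / q : ℕ) * S' : ℝ) ≤ 80 * D * lam * M ∧ 1 ≤ S ∧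
      (480 * D * (D * lam) * M : ℝ) ≤ Q * ((K₀ * D) / 20) ∧
      2 * (D * S') ≤ K₀ * D ∧ 10 ^ 5 ≤ K₀ * D ∧
      (K₀ * D : ℝ) * Q ≤ 9640 * D ^ 2 * lam ^ 2 * M := by
  set ρ : ℝ := 2 * M / (q * Q) with hρ
  have hQ0 : 0 < Q := lt_of_lt_of_le (by positivity) hQ
  have hqR : (1 : ℝ) ≤ q := by exact_mod_cast hq
  have hDR : (20 : ℝ) ≤ D := by exact_mod_cast hD
  have hlamR : (1 : ℝ) ≤ lam := by exact_mod_cast hlam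
  have hQR : (964 * D * lam : ℝ) ≤ Q := by exact_mod_cast hQ
  have hQR0 : (0 : ℝ) < Q := by exact_mod_cast hQ0
  have hqQR : (q ^ 2 * Q : ℝ) ≤ M := by exact_mod_cast hqQ
  have hMρ : ρ * (q * Q) = 2 * M := by
    rw [hρ]
    field_simp
  have hqQ0 : (0 : ℝ) < q * Q := by positivity
  have hρ2 : 2 ≤ ρ := by
    rw [hρ, le_div_iff₀ hqQ0]
    nlinarith
  have hDl : (20 : ℝ) ≤ D * lam := by nlinarith
  have hx : 960 * 10 ≤ 240 * (D * lam) * ρ := by nlinarith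
  set S := ⌈240 * (D * lam) * ρ⌉₊ with hS
  have hS1 : 240 * (D * lam) * ρ ≤ S := Nat.le_ceil _
  have hS2 : (S : ℝ) ≤ 241 * (D * lam) * ρ := by
    have := Nat.ceil_lt_add_one (by positivity : 0 ≤ 240 * (D * lam) * ρ)
    nlinarith
  have hSD : 480 * (D : ℝ) ≤ S := by
    refine le_trans ?_ hS1
    nlinarith
  have hSD' : 480 * D ≤ S := by exact_mod_cast hSD
  have hSr : S ≤ M / q := by
    rw [Nat.le_div_iff_mul_le hq]
    have : (S * q : ℝ) ≤ M := by
      have h1 : (S * q : ℝ) * Q ≤ M * Q := by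
        calc (S * q : ℝ) * Q ≤ 241 * (D * lam) * ρ * q * Q := by gcongr
          _ = 241 * (D * lam) * (ρ * (q * Q)) := by ring
          _ = 482 * (D * lam) * M := by rw [hMρ]; ring
          _ ≤ M * Q := by nlinarith [(Nat.cast_nonneg M : (0 : ℝ) ≤ M)]
      exact le_of_mul_le_mul_right h1 hQR0
    exact_mod_cast this
  have hr : ((M / q : ℕ) : ℝ) * q ≤ M := by exact_mod_cast Nat.div_mul_le_self M q
  have hD0 : 0 < D := by omega
  have hS0 : 0 < S := by omega
  refine ⟨S, 40 * D * q * lam, 20 * S * q * lam, by positivity, by positivity, hSr, ?_, ?_, ?_, ?_,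
    hS0, ?_, ?_, ?_, ?_⟩
  · have h1 : S ≤ 2 * (S + 1 - D) := by omega
    calc D * (20 * S * q * lam) = S * (20 * D * q * lam) := by ring
      _ ≤ 2 * (S + 1 - D) * (20 * D * q * lam) := Nat.mul_le_mul_right _ h1
      _ = _ := by ring
  · push_cast
    apply le_of_eq
    ring
  · push_cast
    have : (D * lam) * ρ ≤ S / 240 := by linarith
    calc (40 * D * q * lam : ℝ) * (ρ * lam) * D = (40 * D * q * lam) * ((D * lam) * ρ) := by ring
      _ ≤ (40 * D * q * lam) * (S / 240) := by gcongr
      _ = _ := by ring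
  · push_cast
    have h1 : (S : ℝ) ≤ (M / q : ℕ) := by exact_mod_cast hSr
    have h2 : (S : ℝ) ≤ (M / q : ℕ) * (40 * D * q * lam) := by
      have h3 : (1 : ℝ) ≤ 40 * D * q * lam := by
        have : 1 ≤ 40 * D * q * lam := Nat.one_le_iff_ne_zero.2 (by positivity)
        exact_mod_cast this
      nlinarith [(Nat.cast_nonneg (M / q) : (0 : ℝ) ≤ (M / q : ℕ))]
    calc (S : ℝ) + (M / q : ℕ) * (40 * D * q * lam)
        ≤ 2 * ((M / q : ℕ) * (40 * D * q * lam)) := by linarith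
      _ = 80 * D * lam * ((M / q : ℕ) * q) := by ring
      _ ≤ 80 * D * lam * M := by gcongr
  · push_cast
    calc (480 * D * (D * lam) * M : ℝ) = 240 * D * (D * lam) * (2 * M) := by ring
      _ = 240 * D * (D * lam) * (ρ * (q * Q)) := by rw [hMρ]
      _ = (240 * (D * lam) * ρ) * (D * q * Q) := by ring
      _ ≤ S * (D * q * Q) := by gcongr
      _ ≤ S * (D * q * Q) * lam := le_mul_of_one_le_right (by positivity) hlamR
      _ = _ := by ring
  · calc 2 * (D * (40 * D * q * lam)) = (4 * D) * (20 * q * lam * D) := by ring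
      _ ≤ S * (20 * q * lam * D) := Nat.mul_le_mul_right _ (by omega)
      _ = _ := by ring
  · have : 480 * 20 ≤ S := by omega
    calc 10 ^ 5 ≤ 20 * (480 * 20) * 1 * 1 * 20 := by norm_num
      _ ≤ 20 * S * q * lam * D := by
        gcongr
        omega
  · push_cast
    calc (20 * S * q * lam * D : ℝ) * Q ≤ (20 * (241 * (D * lam) * ρ) * q * lam * D) * Q := by
          gcongr
      _ = 4820 * D ^ 2 * lam ^ 2 * (ρ * (q * Q)) := by ring
      _ = _ := by rw [hMρ]; ring

namespace NumberField

open IsDedekindDomain nonZeroDivisors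

/-- If `u ≠ 1` is extremely close to `1` at all infinite places, then many exponents in its
factorisation are large. -/
theorem lt_pow_card_of_near_one (K : Type*) [Field K] [NumberField K] : ∃ C : ℕ,
    ∀ (T : Finset (HeightOneSpectrum (𝓞 K))) (b : HeightOneSpectrum (𝓞 K) → ℤ) (u : K)
    (M J Q D lam : ℕ) (τ : ℝ), u ≠ 0 → FractionalIdeal.spanSingleton (𝓞 K)⁰ u = idealProd T b →
    (∀ v ∈ T, (b v).natAbs ≤ M) → (∃ v ∈ T, (b v).natAbs = M) → 0 < M → J ^ 2 * Q ≤ M →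
    ∑ v ∈ T, Real.log (Ideal.absNorm v.asIdeal) ≤ lam → 1 ≤ lam →
    20 * (1 + Real.log (80 * D * lam * M)) ≤ D → 964 * D * lam ≤ Q →
    19280 * D ^ 2 * lam ^ 2 * M ≤ τ * Q → (∀ σ : K →+* ℂ, ‖σ u - 1‖ ≤ Real.exp (-τ)) →
    J + 1 ≤ Q ^ (T.filter fun v => M ≤ (b v).natAbs * (J * Q)).card * (C * (Q * lam)) ^ C := by
  obtain ⟨C, hC⟩ := exists_approx_root K
  refine ⟨C, ?_⟩
  intro T b u M J Q D lam τ hu hub hbM hv0 hM hJQ hsum hlam hDlog hQ hτ hε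
  obtain ⟨v0, hv0T, hv0⟩ := hv0
  by_contra! hlt
  have hMR : (0 : ℝ) < M := by exact_mod_cast hM
  have hlamR : (1 : ℝ) ≤ lam := by exact_mod_cast hlam
  have hD0 : 0 < D := by
    rcases Nat.eq_zero_or_pos D with h0 | h0
    · rw [h0] at hDlog
      norm_num at hDlog
    · exact h0
  have hD20 : 20 ≤ D := by
    have h1 : 0 ≤ Real.log (80 * D * lam * M) := by
      have : 0 ≤ Real.log ((80 * D * lam * M : ℕ) : ℝ) := Real.log_natCast_nonneg _
      push_cast at this
      exact this
    have h2 : (20 : ℝ) ≤ D := by linarith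
    exact_mod_cast h2
  have hQ2 : 2 ≤ Q := by
    have : 1 ≤ D * lam := Nat.mul_pos hD0 hlam
    nlinarith
  have hQR : (2 : ℝ) ≤ Q := by exact_mod_cast hQ2
  have hQR0 : (0 : ℝ) < Q := by linarith
  have hDR : (20 : ℝ) ≤ D := by exact_mod_cast hD20
  have hQR' : (964 * D * lam : ℝ) ≤ Q := by exact_mod_cast hQ
  have hJ1 : 1 ≤ J := by
    have h1 : 1 ≤ (C * (Q * lam)) ^ C := by
      rcases Nat.eq_zero_or_pos C with h0 | h0
      · simp [h0]
      · exact Nat.one_le_pow _ _ (by positivity)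
    have h2 := Nat.mul_le_mul (Nat.one_le_pow
      (T.filter fun v => M ≤ (b v).natAbs * (J * Q)).card Q (by omega)) h1
    omega
  have hτ2 : 2 ≤ τ := by
    have h1 : Q ≤ M := le_trans (Nat.le_mul_of_pos_left _ (by positivity)) hJQ
    have h1R : (Q : ℝ) ≤ M := by exact_mod_cast h1
    have h2 : (1 : ℝ) ≤ D ^ 2 * lam ^ 2 := by
      rw [← mul_pow]
      exact one_le_pow₀ (by nlinarith)
    have h3 : (M : ℝ) ≤ D ^ 2 * lam ^ 2 * M := le_mul_of_one_le_left hMR.le h2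
    have h4 : 2 * (Q : ℝ) ≤ τ * Q := by linarith
    exact le_of_mul_le_mul_right h4 hQR0
  have hexpτ : Real.exp (-τ) ≤ 1 / 2 := by
    have h1 := Real.add_one_le_exp τ
    rw [Real.exp_neg, one_div]
    exact inv_anti₀ (by norm_num) (by linarith)
  have hJM : J ≤ M := by nlinarith
  have hσ1 : ∀ σ : K →+* ℂ, |Real.log ‖σ u‖| ≤ 1 := by
    intro σ
    refine Real.abs_log_le_one_of_abs_sub_one_le ?_
    have h1 := abs_norm_sub_norm_le (σ u) 1
    rw [norm_one] at h1
    exact h1.trans ((hε σ).trans hexpτ)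
  obtain ⟨q, η, m, hq, hqJ, hη, hηm, hm, hw⟩ :=
    hC T b u M J Q lam hu hub hσ1 hM hJM (by omega) hlam hsum hlt
  choose w hw1 hw2 using hw
  have hqR : (1 : ℝ) ≤ q := by exact_mod_cast hq
  have hqQ : q ^ 2 * Q ≤ M := le_trans (by gcongr) hJQ
  have hqQR : (q ^ 2 * Q : ℝ) ≤ M := by exact_mod_cast hqQ
  have hbR : ∀ v ∈ T, |(b v : ℝ)| ≤ M := by
    intro v hv
    have : ((b v).natAbs : ℝ) ≤ M := by exact_mod_cast hbM v hv
    rwa [Nat.cast_natAbs, Int.cast_abs] at this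
  have hm0 : m v0 ≠ 0 := by
    intro h0
    have h1 := hm v0 hv0T
    have h2 : |(b v0 : ℝ)| = M := by
      have : ((b v0).natAbs : ℝ) = M := by exact_mod_cast hv0
      rwa [Nat.cast_natAbs, Int.cast_abs] at this
    rw [h0, Int.cast_zero, zero_mul, zero_sub, abs_neg, abs_mul, h2, Nat.abs_cast] at h1
    nlinarith [mul_le_mul hqR hQR (by norm_num) (by linarith)]
  have hmq : ∀ v ∈ T, |(m v : ℝ)| ≤ q := by
    intro v hv
    have h1 := hm v hv
    have h2 : |(m v : ℝ)| * M ≤ q * M + |(m v : ℝ) * M - q * b v| := by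
      have h3 : |(m v : ℝ) * M| ≤ |(m v : ℝ) * M - q * b v| + |(q * b v : ℝ)| := by
        have := abs_add_le ((m v : ℝ) * M - q * b v) (q * b v)
        rwa [sub_add_cancel] at this
      rw [abs_mul, abs_mul (q : ℝ), Nat.abs_cast, Nat.abs_cast] at h3
      have := mul_le_mul_of_nonneg_left (hbR v hv) (by linarith : (0 : ℝ) ≤ q)
      linarith
    have h4 : |(m v : ℝ)| < q + 1 := by
      by_contra! h5
      have h6 : (q + 1 : ℝ) * M ≤ |(m v : ℝ)| * M := by gcongr
      have h7 : (M : ℝ) ≤ |(m v : ℝ) * M - q * b v| := by linarith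
      nlinarith
    have h8 : |m v| < q + 1 := by exact_mod_cast h4
    exact_mod_cast Int.lt_add_one_iff.1 h8
  have hroot : ∀ t : ℕ, t ≠ 0 → η ^ t ≠ 1 := by
    intro t ht h1
    have h2 : idealProd T (t • m) = 1 := by
      rw [idealProd_nsmul, ← hηm, FractionalIdeal.spanSingleton_pow, h1,
        FractionalIdeal.spanSingleton_one]
    have h3 := count_idealProd T (t • m) hv0T
    rw [h2, FractionalIdeal.count_one] at h3
    simp only [Pi.smul_apply, nsmul_eq_mul] at h3
    rcases mul_eq_zero.1 h3.symm with h4 | h4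
    · exact ht (by exact_mod_cast h4)
    · exact hm0 h4
  set r := M / q with hr
  set ρ : ℝ := 2 * M / (q * Q) with hρ
  have ha : ∀ v ∈ T, |(((b - r • m) v : ℤ) : ℝ)| ≤ ρ := by
    intro v hv
    have hqQ0 : (0 : ℝ) < q * Q := by positivity
    have h1 : |(M : ℝ) - q * r| ≤ q := by
      have h2 : q * r + M % q = M := Nat.div_add_mod M q
      have h2R : (q * r + (M % q : ℕ) : ℝ) = M := by exact_mod_cast h2
      have h3 : ((M % q : ℕ) : ℝ) ≤ q := by exact_mod_cast (Nat.mod_lt M hq).le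
      rw [← h2R, add_sub_cancel_left, Nat.abs_cast]
      exact h3
    rw [hρ, le_div_iff₀ hqQ0]
    have h4 : ((b - r • m) v : ℝ) * q = -((m v : ℝ) * M - q * b v) + m v * (M - q * r) := by
      rw [Pi.sub_apply, Pi.smul_apply, nsmul_eq_mul]
      push_cast
      ring
    have h5 : |((b - r • m) v : ℝ)| * q ≤ |(m v : ℝ) * M - q * b v| + q * q := by
      have h6 : |((b - r • m) v : ℝ)| * q = |((b - r • m) v : ℝ) * q| := by
        rw [abs_mul, Nat.abs_cast]
      rw [h6, h4]
      refine (abs_add_le _ _).trans (add_le_add (abs_neg _).le ?_)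
      rw [abs_mul]
      exact mul_le_mul (hmq v hv) h1 (abs_nonneg _) (by linarith)
    have h7 := hm v hv
    calc |((b - r • m) v : ℝ)| * (q * Q) = |((b - r • m) v : ℝ)| * q * Q := by ring
      _ ≤ (|(m v : ℝ) * M - q * b v| + q * q) * Q := by gcongr
      _ = |(m v : ℝ) * M - q * b v| * Q + q ^ 2 * Q := by ring
      _ ≤ 2 * M := by linarith
  obtain ⟨S, S', K₀, hK₀, hS', hSr, hcard, h1, h2, h3, hS0, h4, h5, h6, h7⟩ :=
    Nat.exists_determinant_parameters hq hD20 hlam hqQ hQ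
  have hηmem : η ∈ idealProd T m := by
    rw [← hηm]
    exact FractionalIdeal.mem_spanSingleton_self _ _
  have hamem : u * (η ^ r)⁻¹ ∈ idealProd T (b - r • m) := by
    rw [idealProd_sub, idealProd_nsmul, ← hηm, ← hub, FractionalIdeal.spanSingleton_pow,
      FractionalIdeal.spanSingleton_inv, FractionalIdeal.spanSingleton_mul_spanSingleton]
    exact FractionalIdeal.mem_spanSingleton_self _ _
  have hpos : ∀ c : HeightOneSpectrum (𝓞 K) → ℤ,
      0 < ∏ v ∈ T, Ideal.absNorm v.asIdeal ^ (c v).natAbs := fun c =>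
    Finset.prod_pos fun v _ => pow_pos (absNorm_asIdeal_pos v) _
  have hρ0 : 0 ≤ ρ := by positivity
  have hmηlog := log_prod_absNorm_pow_le T m hmq hsum (by linarith)
  have hmalog := log_prod_absNorm_pow_le T (b - r • m) ha hsum hρ0
  have hND : ((K₀ * D : ℕ) : ℝ) = K₀ * D := by push_cast; ring
  have hN5 : (10 ^ 5 : ℝ) ≤ K₀ * D := by exact_mod_cast h6
  have hN2 : 2 * (K₀ * D : ℝ) ≤ τ := by
    have : 2 * (K₀ * D : ℝ) * Q ≤ τ * Q := by linarith
    exact le_of_mul_le_mul_right this hQR0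
  have hmain := half_le_of_near_one (S := S) (S' := S') hK₀ hD0 hS' hSr hcard hη hu hroot (hpos m)
    (hpos (b - r • m))
    (isIntegral_prod_absNorm_mul T m hηmem) (isIntegral_prod_absNorm_mul T _ hamem) w hw1
    hw2 hε ?_
  · rw [hND] at hmain
    have hb := Real.numeric_bound_of_large hN5
    have e1 : (D : ℝ) * (S * Real.log ((∏ v ∈ T, Ideal.absNorm v.asIdeal ^ (m v).natAbs : ℕ)) +
        S' * Real.log ((∏ v ∈ T, Ideal.absNorm v.asIdeal ^ ((b - r • m) v).natAbs : ℕ))) ≤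
        K₀ * D / 20 + K₀ * D / 120 := by
      calc _ ≤ (D : ℝ) * (S * (q * lam) + S' * (ρ * lam)) := by gcongr
        _ = S * (q * lam) * D + S' * (ρ * lam) * D := by ring
        _ ≤ _ := add_le_add h1 h2
    have hpos' : (1 : ℝ) ≤ S + r * S' := by
      have : (1 : ℝ) ≤ S := by exact_mod_cast hS0
      have : (0 : ℝ) ≤ r * S' := by positivity
      linarith
    have e2 : (K₀ : ℝ) * (1 + Real.log (S + r * S')) ≤ K₀ * D / 20 := by
      have := Real.log_le_log (by linarith) h3
      have : (1 + Real.log (S + r * S')) ≤ D / 20 := by linarith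
      calc _ ≤ (K₀ : ℝ) * (D / 20) := by gcongr
        _ = _ := by ring
    have e3 : Real.exp 1 * ((D : ℝ) * (2 / Q) * (S + r * S')) ≤ K₀ * D / 20 := by
      have he : Real.exp 1 ≤ 3 := (Real.exp_one_lt_d9.trans (by norm_num)).le
      have h8 : Real.exp 1 * ((D : ℝ) * (2 / Q) * (S + r * S')) * Q ≤ (K₀ * D / 20) * Q := by
        calc Real.exp 1 * ((D : ℝ) * (2 / Q) * (S + r * S')) * Q
            = Real.exp 1 * (2 * D * (S + r * S')) := by field_simp
          _ ≤ 3 * (2 * D * (80 * D * lam * M)) := by gcongr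
          _ = 480 * D * (D * lam) * M := by ring
          _ ≤ _ := by linarith
      exact le_of_mul_le_mul_right h8 hQR0
    linarith
  · rw [hND]
    have h8 : (2 * (D * S') : ℝ) ≤ K₀ * D := by exact_mod_cast h5
    have h9 : Real.exp (-τ) ≤ Real.exp (-(K₀ * D)) * Real.exp (-(K₀ * D)) := by
      rw [← Real.exp_add]
      exact Real.exp_le_exp.2 (by linarith)
    have h10 : (K₀ * D : ℝ) * Real.exp (-(K₀ * D)) ≤ 1 := by
      rw [Real.exp_neg, ← div_eq_mul_inv, div_le_one (Real.exp_pos _)]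
      linarith [Real.add_one_le_exp (K₀ * D : ℝ)]
    calc (2 * (D * S') : ℝ) * Real.exp (-τ)
        ≤ (K₀ * D) * (Real.exp (-(K₀ * D)) * Real.exp (-(K₀ * D))) := by gcongr
      _ = ((K₀ * D) * Real.exp (-(K₀ * D))) * Real.exp (-(K₀ * D)) := by ring
      _ ≤ 1 * Real.exp (-(K₀ * D)) := by gcongr
      _ = _ := one_mul _

end NumberField

namespace NumberField

open IsDedekindDomain nonZeroDivisors

variable {K : Type*} [Field K] [NumberField K]

/-- The order of vanishing of an algebraic integer at a finite place. -/
noncomputable def ordAt (v : HeightOneSpectrum (𝓞 K)) (x : 𝓞 K) : ℕ :=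
  multiplicity v.asIdeal (Ideal.span {x})

theorem span_singleton_ne_bot' {K : Type*} [Field K] {x : 𝓞 K} (hx : x ≠ 0) :
    Ideal.span {x} ≠ (⊥ : Ideal (𝓞 K)) := by
  rwa [Ne, Ideal.span_singleton_eq_bot]

theorem finiteMultiplicity_span (v : HeightOneSpectrum (𝓞 K)) {x : 𝓞 K} (hx : x ≠ 0) :
    FiniteMultiplicity v.asIdeal (Ideal.span {x}) :=
  FiniteMultiplicity.of_prime_left v.prime (span_singleton_ne_bot' hx)

theorem le_ordAt_iff (v : HeightOneSpectrum (𝓞 K)) {x : 𝓞 K} (hx : x ≠ 0) {k : ℕ} :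
    k ≤ ordAt v x ↔ x ∈ v.asIdeal ^ k := by
  rw [ordAt, ← (finiteMultiplicity_span v hx).pow_dvd_iff_le_multiplicity,
    Ideal.dvd_span_singleton]

theorem ordAt_mul (v : HeightOneSpectrum (𝓞 K)) {x y : 𝓞 K} (hx : x ≠ 0) (hy : y ≠ 0) :
    ordAt v (x * y) = ordAt v x + ordAt v y := by
  rw [ordAt, ← Ideal.span_singleton_mul_span_singleton, multiplicity_mul v.prime]
  · rfl
  · rw [Ideal.span_singleton_mul_span_singleton]
    exact finiteMultiplicity_span v (mul_ne_zero hx hy)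

theorem ordAt_le_of_dvd (v : HeightOneSpectrum (𝓞 K)) {x y : 𝓞 K} (hy : y ≠ 0) (h : x ∣ y) :
    ordAt v x ≤ ordAt v y := by
  obtain ⟨z, rfl⟩ := h
  rw [ordAt_mul v (left_ne_zero_of_mul hy) (right_ne_zero_of_mul hy)]
  exact Nat.le_add_right _ _

theorem ordAt_pow (v : HeightOneSpectrum (𝓞 K)) {x : 𝓞 K} (hx : x ≠ 0) (k : ℕ) :
    ordAt v (x ^ k) = k * ordAt v x := by
  rw [ordAt, ← Ideal.span_singleton_pow, FiniteMultiplicity.multiplicity_pow v.prime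
    (finiteMultiplicity_span v hx)]
  rfl

theorem one_le_ordAt_iff (v : HeightOneSpectrum (𝓞 K)) {x : 𝓞 K} (hx : x ≠ 0) :
    1 ≤ ordAt v x ↔ x ∈ v.asIdeal := by
  rw [le_ordAt_iff v hx, pow_one]

theorem min_le_ordAt_sub (v : HeightOneSpectrum (𝓞 K)) {x y : 𝓞 K} (hx : x ≠ 0) (hy : y ≠ 0)
    (hxy : x - y ≠ 0) : min (ordAt v x) (ordAt v y) ≤ ordAt v (x - y) := by
  rw [le_ordAt_iff v hxy]
  exact Ideal.sub_mem _ ((le_ordAt_iff v hx).1 (min_le_left _ _))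
    ((le_ordAt_iff v hy).1 (min_le_right _ _))

theorem two_le_absNorm_asIdeal (v : HeightOneSpectrum (𝓞 K)) : 2 ≤ Ideal.absNorm v.asIdeal := by
  have h1 : Ideal.absNorm v.asIdeal ≠ 0 := Ideal.absNorm_eq_zero_iff.not.2 v.ne_bot
  have h2 : Ideal.absNorm v.asIdeal ≠ 1 := Ideal.absNorm_eq_one_iff.not.2 v.isPrime.ne_top
  omega

theorem absNorm_pow_ordAt_dvd (v : HeightOneSpectrum (𝓞 K)) {x : 𝓞 K} (hx : x ≠ 0) :
    Ideal.absNorm v.asIdeal ^ ordAt v x ∣ Ideal.absNorm (Ideal.span {x}) := by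
  rw [← map_pow]
  apply Ideal.absNorm_dvd_absNorm_of_le
  rw [Ideal.span_singleton_le_iff_mem]
  exact (le_ordAt_iff v hx).1 le_rfl

theorem absNorm_span_pos {x : 𝓞 K} (hx : x ≠ 0) : 0 < Ideal.absNorm (Ideal.span {x}) :=
  Nat.pos_of_ne_zero (Ideal.absNorm_eq_zero_iff.not.2 (span_singleton_ne_bot' hx))

theorem two_pow_ordAt_le (v : HeightOneSpectrum (𝓞 K)) {x : 𝓞 K} (hx : x ≠ 0) :
    2 ^ ordAt v x ≤ Ideal.absNorm (Ideal.span {x}) :=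
  (Nat.pow_le_pow_left (two_le_absNorm_asIdeal v) _).trans
    (Nat.le_of_dvd (absNorm_span_pos hx) (absNorm_pow_ordAt_dvd v hx))

theorem finite_setOf_mem_asIdeal {x : 𝓞 K} (hx : x ≠ 0) :
    {v : HeightOneSpectrum (𝓞 K) | x ∈ v.asIdeal}.Finite := by
  have := Ideal.finite_factors (span_singleton_ne_bot' hx)
  simpa only [Ideal.dvd_span_singleton] using this

theorem span_singleton_eq_prod (T : Finset (HeightOneSpectrum (𝓞 K))) {x : 𝓞 K} (hx : x ≠ 0)
    (hT : ∀ v : HeightOneSpectrum (𝓞 K), x ∈ v.asIdeal → v ∈ T) :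
    Ideal.span {x} = ∏ v ∈ T, v.asIdeal ^ ordAt v x := by
  rw [← finprod_eq_prod_of_mulSupport_subset]
  · exact (Ideal.finprod_heightOneSpectrum_pow_multiplicity (span_singleton_ne_bot' hx)).symm
  · intro v hv
    rw [Function.mem_mulSupport] at hv
    refine hT v ((one_le_ordAt_iff v hx).1 (Nat.one_le_iff_ne_zero.2 fun h => hv ?_))
    rw [h, pow_zero]

theorem spanSingleton_eq_idealProd (T : Finset (HeightOneSpectrum (𝓞 K))) {x : 𝓞 K} (hx : x ≠ 0)
    (hT : ∀ v : HeightOneSpectrum (𝓞 K), x ∈ v.asIdeal → v ∈ T) :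
    FractionalIdeal.spanSingleton (𝓞 K)⁰ (x : K) = idealProd T fun v => (ordAt v x : ℤ) := by
  have h := FractionalIdeal.coeIdeal_span_singleton (S := (𝓞 K)⁰) (P := K) x
  rw [← h, span_singleton_eq_prod T hx hT, coeIdeal_prod, idealProd]
  refine Finset.prod_congr rfl fun v _ => ?_
  rw [FractionalIdeal.coeIdeal_pow, zpow_natCast]

theorem log_absNorm_span_eq_sum (T : Finset (HeightOneSpectrum (𝓞 K))) {x : 𝓞 K} (hx : x ≠ 0)
    (hT : ∀ v : HeightOneSpectrum (𝓞 K), x ∈ v.asIdeal → v ∈ T) :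
    Real.log (Ideal.absNorm (Ideal.span {x})) =
      ∑ v ∈ T, ordAt v x * Real.log (Ideal.absNorm v.asIdeal) := by
  rw [span_singleton_eq_prod T hx hT, map_prod]
  push_cast
  rw [Real.log_prod]
  · refine Finset.sum_congr rfl fun v _ => ?_
    rw [map_pow]
    push_cast
    rw [Real.log_pow]
  · intro v _
    have := absNorm_asIdeal_pos v
    rw [map_pow]
    positivity

theorem sum_log_absNorm_le (T : Finset (HeightOneSpectrum (𝓞 K))) {m : ℕ} (hm : m ≠ 0)
    (hT : ∀ v ∈ T, (m : 𝓞 K) ∈ v.asIdeal) :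
    ∑ v ∈ T, Real.log (Ideal.absNorm v.asIdeal) ≤ Module.finrank ℚ K * Real.log m := by
  have hm' : (m : 𝓞 K) ≠ 0 := Nat.cast_ne_zero.2 hm
  have hfin := finite_setOf_mem_asIdeal hm'
  have h1 := log_absNorm_span_eq_sum hfin.toFinset hm' (by simp)
  rw [Ideal.absNorm_span_natCast, RingOfIntegers.rank] at h1
  push_cast at h1
  rw [Real.log_pow] at h1
  rw [h1]
  calc ∑ v ∈ T, Real.log (Ideal.absNorm v.asIdeal)
      ≤ ∑ v ∈ T, ordAt v (m : 𝓞 K) * Real.log (Ideal.absNorm v.asIdeal) := by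
        refine Finset.sum_le_sum fun v hv => ?_
        refine le_mul_of_one_le_left (log_absNorm_asIdeal_nonneg v) ?_
        exact_mod_cast (one_le_ordAt_iff v hm').2 (hT v hv)
    _ ≤ _ := by
        refine Finset.sum_le_sum_of_subset_of_nonneg (fun v hv => ?_) fun v _ _ =>
          mul_nonneg (Nat.cast_nonneg _) (log_absNorm_asIdeal_nonneg v)
        simpa using hT v hv

theorem prime_le_absNorm {p : ℕ} (hp : p.Prime) (v : HeightOneSpectrum (𝓞 K))
    (hv : (p : 𝓞 K) ∈ v.asIdeal) : p ≤ Ideal.absNorm v.asIdeal := by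
  have h1 : Ideal.absNorm v.asIdeal ∣ p ^ Module.finrank ℤ (𝓞 K) := by
    rw [← Ideal.absNorm_span_natCast]
    apply Ideal.absNorm_dvd_absNorm_of_le
    rwa [Ideal.span_singleton_le_iff_mem]
  obtain ⟨k, _, hk⟩ := (Nat.dvd_prime_pow hp).1 h1
  have h2 := two_le_absNorm_asIdeal v
  refine Nat.le_of_dvd (by omega) ?_
  rw [hk]
  refine dvd_pow_self _ fun h0 => ?_
  rw [hk, h0, pow_zero] at h2
  omega

theorem card_le_finrank_of_prime_mem (T : Finset (HeightOneSpectrum (𝓞 K))) {p : ℕ}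
    (hp : p.Prime) (hT : ∀ v ∈ T, (p : 𝓞 K) ∈ v.asIdeal) : T.card ≤ Module.finrank ℚ K := by
  have h1 := sum_log_absNorm_le T hp.ne_zero hT
  have hlog : 0 < Real.log p := Real.log_pos (by exact_mod_cast hp.one_lt)
  have h2 : T.card * Real.log p ≤ Module.finrank ℚ K * Real.log p := by
    refine le_trans ?_ h1
    rw [← nsmul_eq_mul]
    refine Finset.card_nsmul_le_sum _ _ _ fun v hv => ?_
    refine Real.log_le_log (by exact_mod_cast hp.pos) ?_
    exact_mod_cast prime_le_absNorm hp v (hT v hv)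
  exact_mod_cast le_of_mul_le_mul_right h2 hlog

theorem ordAt_prime_le {p : ℕ} (hp : p.Prime) (v : HeightOneSpectrum (𝓞 K))
    (hv : (p : 𝓞 K) ∈ v.asIdeal) : ordAt v (p : 𝓞 K) ≤ Module.finrank ℚ K := by
  have hp0 : (p : 𝓞 K) ≠ 0 := Nat.cast_ne_zero.2 hp.ne_zero
  have h1 := Nat.le_of_dvd (absNorm_span_pos hp0) (absNorm_pow_ordAt_dvd v hp0)
  rw [Ideal.absNorm_span_natCast, RingOfIntegers.rank] at h1
  exact (Nat.pow_le_pow_iff_right hp.one_lt).1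
    ((Nat.pow_le_pow_left (prime_le_absNorm hp v hv) _).trans h1)

theorem ordAt_intCast_le {p : ℕ} (hp : p.Prime) (v : HeightOneSpectrum (𝓞 K))
    (hv : (p : 𝓞 K) ∈ v.asIdeal) {m : ℤ} (hm : m ≠ 0) :
    ordAt v (m : 𝓞 K) ≤ Module.finrank ℚ K * padicValInt p m := by
  have := Fact.mk hp
  obtain ⟨t, ht⟩ : (p : ℤ) ^ padicValInt p m ∣ m := padicValInt_dvd m
  have ht0 : t ≠ 0 := by
    rintro rfl
    simp at ht
    exact hm ht
  have hpt : ¬ (p : ℤ) ∣ t := by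
    rintro ⟨s, rfl⟩
    have h1 : (p : ℤ) ^ (padicValInt p m + 1) ∣ m := ⟨s, by rw [pow_succ, mul_assoc]; exact ht⟩
    rw [padicValInt_dvd_iff] at h1
    rcases h1 with h1 | h1
    · exact hm h1
    · omega
  have ht1 : ordAt v (t : 𝓞 K) = 0 := by
    by_contra h0
    have h1 := (one_le_ordAt_iff v (Int.cast_ne_zero.2 ht0)).1 (Nat.one_le_iff_ne_zero.2 h0)
    obtain ⟨a, b, hab⟩ := (Prime.coprime_iff_not_dvd (Nat.prime_iff_prime_int.1 hp)).2 hpt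
    apply v.isPrime.ne_top
    rw [Ideal.eq_top_iff_one]
    have h2 : (1 : 𝓞 K) = a * p + b * t := by exact_mod_cast hab.symm
    rw [h2]
    exact Ideal.add_mem _ (Ideal.mul_mem_left _ _ hv) (Ideal.mul_mem_left _ _ h1)
  have hp0 : (p : 𝓞 K) ≠ 0 := Nat.cast_ne_zero.2 hp.ne_zero
  have h3 : (m : 𝓞 K) = (p : 𝓞 K) ^ padicValInt p m * t := by
    conv_lhs => rw [ht]
    push_cast
    rfl
  rw [h3, ordAt_mul v (pow_ne_zero _ hp0) (Int.cast_ne_zero.2 ht0), ht1, add_zero,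
    ordAt_pow v hp0, mul_comm]
  exact Nat.mul_le_mul_right _ (ordAt_prime_le hp v hv)

end NumberField

theorem Ideal.IsPrime.exists_prime_natCast_mem {R : Type*} [CommRing R] {P : Ideal R}
    (hP : P.IsPrime) {m : ℕ} (hm : m ≠ 0) (h : (m : R) ∈ P) :
    ∃ p : ℕ, p.Prime ∧ p ∣ m ∧ (p : R) ∈ P := by
  induction m using Nat.recOnMul with
  | zero => exact absurd rfl hm
  | one => exact absurd ((Ideal.eq_top_iff_one P).2 (by simpa using h)) hP.ne_top
  | prime p hp => exact ⟨p, hp, dvd_rfl, h⟩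
  | mul a b iha ihb =>
    rw [Nat.cast_mul] at h
    rcases hP.mem_or_mem h with h | h
    · obtain ⟨p, hp, hd, hmem⟩ := iha (left_ne_zero_of_mul hm) h
      exact ⟨p, hp, hd.mul_right _, hmem⟩
    · obtain ⟨p, hp, hd, hmem⟩ := ihb (right_ne_zero_of_mul hm) h
      exact ⟨p, hp, hd.mul_left _, hmem⟩

theorem padicValInt_le_natAbs {p : ℕ} (hp : p.Prime) (m : ℤ) : padicValInt p m ≤ m.natAbs := by
  rcases eq_or_ne m 0 with rfl | hm
  · simp
  · have h1 := Nat.le_of_dvd (Int.natAbs_pos.2 hm) (pow_padicValNat_dvd (p := p) (n := m.natAbs))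
    exact (Nat.lt_pow_self hp.one_lt).le.trans h1

theorem padicValInt_le_prod {p : ℕ} (hp : p.Prime) {m : ℤ} (hm : m ≠ 0) :
    padicValInt p m ≤ ∏ q ∈ m.natAbs.primeFactors, padicValInt q m := by
  have hpos : ∀ q ∈ m.natAbs.primeFactors, 0 < padicValInt q m := by
    intro q hq
    have := Fact.mk (Nat.prime_of_mem_primeFactors hq)
    exact one_le_padicValNat_of_dvd (Int.natAbs_ne_zero.2 hm) (Nat.dvd_of_mem_primeFactors hq)
  by_cases h : p ∈ m.natAbs.primeFactors
  · exact Nat.le_of_dvd (Finset.prod_pos hpos) (Finset.dvd_prod_of_mem _ h)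
  · have h1 : ¬ p ∣ m.natAbs := fun h2 =>
      h (Nat.mem_primeFactors.2 ⟨hp, h2, Int.natAbs_ne_zero.2 hm⟩)
    rw [padicValInt, padicValNat.eq_zero_of_not_dvd h1]
    exact Nat.zero_le _

theorem one_le_prod_padicValInt {m : ℤ} (hm : m ≠ 0) :
    1 ≤ ∏ q ∈ m.natAbs.primeFactors, padicValInt q m := by
  refine Nat.one_le_iff_ne_zero.2 (Finset.prod_ne_zero_iff.2 fun q hq => ?_)
  have := Fact.mk (Nat.prime_of_mem_primeFactors hq)
  exact Nat.one_le_iff_ne_zero.1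
    (one_le_padicValNat_of_dvd (Int.natAbs_ne_zero.2 hm) (Nat.dvd_of_mem_primeFactors hq))

/-- An upper bound for the number of elements attached to a large exponent. -/
theorem pow_card_le_prod_padicValInt {ι : Type*} (A : Finset ι) (p : ι → ℕ) {m : ℤ} (hm : m ≠ 0)
    {d : ℕ} (hp : ∀ i ∈ A, p i ∈ m.natAbs.primeFactors)
    (hfib : ∀ q, (A.filter fun i => p i = q).card ≤ d) {y : ℝ} (hy : 1 ≤ y)
    (hA : ∀ i ∈ A, y ≤ padicValInt (p i) m) :
    y ^ A.card ≤ ((∏ q ∈ m.natAbs.primeFactors, padicValInt q m : ℕ) : ℝ) ^ d := by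
  classical
  have h1 : A.card ≤ d * (A.image p).card :=
    Finset.card_le_mul_card_image A d fun q _ => hfib q
  have hpos : ∀ q ∈ m.natAbs.primeFactors, 1 ≤ padicValInt q m := by
    intro q hq
    have := Fact.mk (Nat.prime_of_mem_primeFactors hq)
    exact one_le_padicValNat_of_dvd (Int.natAbs_ne_zero.2 hm) (Nat.dvd_of_mem_primeFactors hq)
  have hsub : A.image p ⊆ m.natAbs.primeFactors := Finset.image_subset_iff.2 hp
  calc y ^ A.card ≤ y ^ (d * (A.image p).card) := pow_le_pow_right₀ hy h1
    _ = (y ^ (A.image p).card) ^ d := by rw [mul_comm, pow_mul]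
    _ ≤ _ := by
      gcongr
      push_cast
      calc y ^ (A.image p).card = ∏ _q ∈ A.image p, y := by rw [Finset.prod_const]
        _ ≤ ∏ q ∈ A.image p, (padicValInt q m : ℝ) := by
          refine Finset.prod_le_prod (fun _ _ => by linarith) fun q hq => ?_
          obtain ⟨i, hi, rfl⟩ := Finset.mem_image.1 hq
          exact hA i hi
        _ ≤ _ := by
          have h2 := Finset.prod_le_prod_of_subset_of_one_le' hsub
            (f := fun q => padicValInt q m) fun q hq _ => hpos q hq
          exact_mod_cast h2

namespace NumberField

open IsDedekindDomain nonZeroDivisors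

variable {K : Type*} [Field K] [NumberField K]

theorem log_absNorm_span_eq_sum_infinitePlace {x : 𝓞 K} (hx : x ≠ 0) :
    Real.log (Ideal.absNorm (Ideal.span {x})) =
      ∑ w : InfinitePlace K, w.mult * Real.log (w (x : K)) := by
  have hx' : (x : K) ≠ 0 := by simpa using hx
  have h1 : (Ideal.absNorm (Ideal.span {x}) : ℝ) = ∏ w : InfinitePlace K, w (x : K) ^ w.mult := by
    rw [InfinitePlace.prod_eq_abs_norm, Ideal.absNorm_span_singleton, ← Algebra.coe_norm_int]
    push_cast
    rw [Nat.cast_natAbs]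
    push_cast
    rfl
  rw [h1, Real.log_prod]
  · exact Finset.sum_congr rfl fun w _ => Real.log_pow _ _
  · exact fun w _ => pow_ne_zero _ ((map_ne_zero w).2 hx')

theorem log_absNorm_span_le {x : 𝓞 K} (hx : x ≠ 0) {A : ℝ} (h : ∀ σ : K →+* ℂ, ‖σ x‖ ≤ A) :
    Real.log (Ideal.absNorm (Ideal.span {x})) ≤ Module.finrank ℚ K * Real.log A := by
  rw [log_absNorm_span_eq_sum_infinitePlace hx, ← InfinitePlace.sum_mult_eq]
  push_cast
  rw [Finset.sum_mul]
  refine Finset.sum_le_sum fun w _ => ?_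
  have hx' : (x : K) ≠ 0 := by simpa using hx
  refine mul_le_mul_of_nonneg_left (Real.log_le_log (InfinitePlace.pos_iff.2 hx') ?_)
    (Nat.cast_nonneg _)
  rw [← InfinitePlace.norm_embedding_eq]
  exact h _

theorem le_log_absNorm_span {x : 𝓞 K} (hx : x ≠ 0) {A : ℝ} (hA : 1 ≤ A)
    (h : ∀ σ : K →+* ℂ, A ≤ ‖σ x‖) :
    Real.log A ≤ Real.log (Ideal.absNorm (Ideal.span {x})) := by
  have hd : 1 ≤ Module.finrank ℚ K := Module.finrank_pos
  have h0 := Real.log_nonneg hA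
  calc Real.log A ≤ Module.finrank ℚ K * Real.log A :=
        le_mul_of_one_le_left h0 (by exact_mod_cast hd)
    _ ≤ _ := by
      rw [log_absNorm_span_eq_sum_infinitePlace hx, ← InfinitePlace.sum_mult_eq]
      push_cast
      rw [Finset.sum_mul]
      refine Finset.sum_le_sum fun w _ => ?_
      refine mul_le_mul_of_nonneg_left (Real.log_le_log (by linarith) ?_) (Nat.cast_nonneg _)
      rw [← InfinitePlace.norm_embedding_eq]
      exact h _

theorem exists_norm_embedding_le (x : K) : ∃ B : ℕ, ∀ σ : K →+* ℂ, ‖σ x‖ ≤ B := by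
  obtain ⟨B, hB⟩ := (Set.finite_range fun σ : K →+* ℂ => ‖σ x‖).bddAbove
  refine ⟨⌈B⌉₊, fun σ => (hB ⟨σ, rfl⟩).trans (Nat.le_ceil _)⟩

end NumberField

theorem Ideal.natCast_natAbs_mem {R : Type*} [CommRing R] {I : Ideal R} {k : ℤ}
    (h : (k : R) ∈ I) : (k.natAbs : R) ∈ I := by
  obtain ⟨j, rfl | rfl⟩ := Int.eq_nat_or_neg k
  · simpa using h
  · simpa using h

namespace NumberField

open IsDedekindDomain nonZeroDivisors

set_option maxHeartbeats 1000000 in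
/-- Two distinct roots of a polynomial taking the value `m` at `n` give rise to an element `u`
close to `1` whose factorisation is controlled by that of `m`. -/
theorem exists_near_one (K : Type*) [Field K] [NumberField K] {ϑ₁ ϑ₂ : 𝓞 K} (hϑ : ϑ₁ ≠ ϑ₂)
    {e E : ℤ} (he : e ≠ 0) (hE : E ≠ 0) : ∃ C : ℕ, 1 ≤ C ∧ ∀ n m : ℤ, m ≠ 0 → (C : ℤ) ≤ |n| →
    (e * n - ϑ₁ : 𝓞 K) ∣ E * m → (e * n - ϑ₂ : 𝓞 K) ∣ E * m →
    ∃ (T : Finset (HeightOneSpectrum (𝓞 K))) (b : HeightOneSpectrum (𝓞 K) → ℤ) (u : K), u ≠ 0 ∧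
      FractionalIdeal.spanSingleton (𝓞 K)⁰ u = idealProd T b ∧
      (∀ σ : K →+* ℂ, ‖σ u - 1‖ ≤ C / |(n : ℝ)|) ∧
      ∑ v ∈ T, Real.log (Ideal.absNorm v.asIdeal) ≤
        C * (1 + Real.log ((∏ p ∈ m.natAbs.primeFactors, p : ℕ))) ∧
      (∀ M : ℕ, (∀ v ∈ T, (b v).natAbs ≤ M) → Real.log |(n : ℝ)| ≤
        C * (1 + Real.log ((∏ p ∈ m.natAbs.primeFactors, p : ℕ))) * (M + 1)) ∧
      (∀ v ∈ T, ((b v).natAbs : ℝ) ≤ C * Real.log |(n : ℝ)|) ∧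
      (∀ v ∈ T, (b v).natAbs ≤ C * (1 + ∏ p ∈ m.natAbs.primeFactors, padicValInt p m)) ∧
      ∀ Y : ℝ, C ≤ Y → (Y / C) ^ (T.filter fun v => Y ≤ (b v).natAbs).card ≤
        ((∏ p ∈ m.natAbs.primeFactors, padicValInt p m : ℕ) : ℝ) ^ C := by
  classical
  obtain ⟨B₁, hB₁⟩ := exists_norm_embedding_le (ϑ₁ : K)
  obtain ⟨B₂, hB₂⟩ := exists_norm_embedding_le (ϑ₂ : K)
  set B := B₁ + B₂ with hB
  set d := Module.finrank ℚ K with hd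
  have hd1 : 1 ≤ d := Module.finrank_pos
  set En := E.natAbs with hEn
  have hEn1 : 1 ≤ En := Int.natAbs_pos.2 hE
  have hsub : ϑ₂ - ϑ₁ ≠ 0 := sub_ne_zero.2 hϑ.symm
  set E₀ := Ideal.absNorm (Ideal.span {ϑ₂ - ϑ₁}) with hE₀
  set D := d * (En + 1) with hD
  set G := 4 * (E₀ + 1) * D with hG
  have hD1 : 1 ≤ D := Nat.mul_pos hd1 (Nat.succ_pos _)
  have hDG : 4 * D ≤ G := by
    rw [hG]
    nlinarith
  have hdD : d ≤ D := Nat.le_mul_of_pos_right _ (Nat.succ_pos _)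
  have hdE : d * En ≤ D := Nat.mul_le_mul_left _ (Nat.le_succ _)
  refine ⟨4 * B + 4 + e.natAbs + G, by omega, ?_⟩
  set C := 4 * B + 4 + e.natAbs + G with hC
  intro n m hm hn hdvd₁ hdvd₂
  have hEm : E * m ≠ 0 := mul_ne_zero hE hm
  have hEm' : (E * m : 𝓞 K) ≠ 0 := by exact_mod_cast hEm
  set x₁ : 𝓞 K := e * n - ϑ₁ with hx₁
  set x₂ : 𝓞 K := e * n - ϑ₂ with hx₂
  have hx₁0 : x₁ ≠ 0 := ne_zero_of_dvd_ne_zero hEm' hdvd₁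
  have hx₂0 : x₂ ≠ 0 := ne_zero_of_dvd_ne_zero hEm' hdvd₂
  have hxx : x₁ - x₂ = ϑ₂ - ϑ₁ := by
    rw [hx₁, hx₂]
    ring
  have hnR : (C : ℝ) ≤ |(n : ℝ)| := by exact_mod_cast hn
  have hCR : (C : ℝ) = 4 * B + 4 + |(e : ℝ)| + G := by
    rw [hC]
    push_cast
    rw [Nat.cast_natAbs]
    push_cast
    ring
  have heR : (1 : ℝ) ≤ |(e : ℝ)| := by exact_mod_cast Int.one_le_abs he
  have hGR : (0 : ℝ) ≤ G := Nat.cast_nonneg _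
  have hBR : (0 : ℝ) ≤ B := Nat.cast_nonneg _
  have hn0 : (0 : ℝ) < |(n : ℝ)| := by linarith
  have hBB₁ : ∀ σ : K →+* ℂ, ‖σ ϑ₁‖ ≤ B := fun σ =>
    (hB₁ σ).trans (Nat.cast_le.2 (Nat.le_add_right _ _))
  have hBB₂ : ∀ σ : K →+* ℂ, ‖σ ϑ₂‖ ≤ B := fun σ =>
    (hB₂ σ).trans (Nat.cast_le.2 (Nat.le_add_left _ _))
  have hσx : ∀ (ϑ : 𝓞 K) (σ : K →+* ℂ), ‖σ ϑ‖ ≤ B →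
      |(n : ℝ)| / 2 ≤ ‖σ (e * n - ϑ : 𝓞 K)‖ ∧ ‖σ (e * n - ϑ : 𝓞 K)‖ ≤ |(n : ℝ)| ^ 2 := by
    intro ϑ σ hσ
    have h1 : σ (e * n - ϑ : 𝓞 K) = (e : ℂ) * n - σ ϑ := by
      push_cast
      simp
    have h2 : ‖(e : ℂ) * n‖ = |(e : ℝ)| * |(n : ℝ)| := by
      rw [norm_mul, Complex.norm_intCast, Complex.norm_intCast]
    rw [h1]
    constructor
    · have h3 := norm_sub_norm_le ((e : ℂ) * n) (σ ϑ)
      rw [h2] at h3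
      nlinarith
    · have h3 := norm_sub_le ((e : ℂ) * n) (σ ϑ)
      rw [h2] at h3
      nlinarith
  set T := (finite_setOf_mem_asIdeal (mul_ne_zero hx₁0 hx₂0)).toFinset with hT
  have hmemT : ∀ v, v ∈ T ↔ x₁ * x₂ ∈ v.asIdeal := fun v => by
    rw [hT, Set.Finite.mem_toFinset]
    rfl
  have hT₁ : ∀ v : HeightOneSpectrum (𝓞 K), x₁ ∈ v.asIdeal → v ∈ T := fun v hv =>
    (hmemT v).2 (Ideal.mul_mem_right _ _ hv)
  have hT₂ : ∀ v : HeightOneSpectrum (𝓞 K), x₂ ∈ v.asIdeal → v ∈ T := fun v hv =>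
    (hmemT v).2 (Ideal.mul_mem_left _ _ hv)
  have hprime : ∀ v ∈ T, ∃ p : ℕ, p.Prime ∧ p ∣ (E * m).natAbs ∧ (p : 𝓞 K) ∈ v.asIdeal := by
    intro v hv
    refine v.isPrime.exists_prime_natCast_mem (Int.natAbs_ne_zero.2 hEm) ?_
    have h1 : (E * m : 𝓞 K) ∈ v.asIdeal := by
      rcases v.isPrime.mem_or_mem ((hmemT v).1 hv) with h | h
      · exact Ideal.mem_of_dvd _ hdvd₁ h
      · exact Ideal.mem_of_dvd _ hdvd₂ h
    exact Ideal.natCast_natAbs_mem (by rwa [Int.cast_mul])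
  set R := ∏ p ∈ m.natAbs.primeFactors, p with hR
  set P := ∏ p ∈ m.natAbs.primeFactors, padicValInt p m with hP
  have hR1 : 1 ≤ R := Finset.prod_pos fun p hp => (Nat.prime_of_mem_primeFactors hp).pos
  have hlogR : 0 ≤ Real.log R := Real.log_natCast_nonneg _
  have hsum : ∑ v ∈ T, Real.log (Ideal.absNorm v.asIdeal) ≤ D * (1 + Real.log R) := by
    have h1 := sum_log_absNorm_le T (m := En * R) (Nat.mul_ne_zero (by omega) (by omega)) ?_
    · push_cast at h1
      rw [Real.log_mul (by positivity) (by positivity)] at h1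
      refine h1.trans ?_
      have h2 : Real.log En ≤ En := Real.log_le_self (Nat.cast_nonneg _)
      have h3 : (d : ℝ) * (Real.log En + Real.log R) ≤ d * ((En + 1) * (1 + Real.log R)) := by
        gcongr
        nlinarith [(Nat.cast_nonneg En : (0 : ℝ) ≤ En)]
      refine h3.trans (le_of_eq ?_)
      rw [hD]
      push_cast
      ring
    · intro v hv
      obtain ⟨p, hp, hpd, hpv⟩ := hprime v hv
      have h2 : p ∣ En * R := by
        rw [Int.natAbs_mul] at hpd
        rcases hp.dvd_mul.1 hpd with h3 | h3
        · exact h3.mul_right _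
        · exact (Finset.dvd_prod_of_mem _ (Nat.mem_primeFactors.2
            ⟨hp, h3, Int.natAbs_ne_zero.2 hm⟩)).mul_left _
      obtain ⟨t, ht⟩ := h2
      rw [ht]
      push_cast
      exact Ideal.mul_mem_right _ _ hpv
  have hord : ∀ v ∈ T, ∀ p : ℕ, p.Prime → (p : 𝓞 K) ∈ v.asIdeal →
      ((ordAt v x₁ : ℤ) - ordAt v x₂).natAbs ≤ d * (En + padicValInt p m) := by
    intro v hv p hp hpv
    have := Fact.mk hp
    have h1 := ordAt_intCast_le hp v hpv hEm
    rw [padicValInt.mul hE hm] at h1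
    rw [Int.cast_mul] at h1
    have h2 := ordAt_le_of_dvd v hEm' hdvd₁
    have h3 := ordAt_le_of_dvd v hEm' hdvd₂
    have h4 := Nat.mul_le_mul_left d
      (Nat.add_le_add_right (padicValInt_le_natAbs hp E) (padicValInt p m))
    have h5 := h2.trans (h1.trans h4)
    have h6 := h3.trans (h1.trans h4)
    generalize d * (En + padicValInt p m) = N at h5 h6 ⊢
    omega
  have hx₁K : (x₁ : K) ≠ 0 := by simpa using hx₁0
  have hx₂K : (x₂ : K) ≠ 0 := by simpa using hx₂0
  have hGC : G ≤ C := by omega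
  have hDC : D ≤ C := by omega
  have hlogn : 0 ≤ Real.log |(n : ℝ)| := Real.log_nonneg (by linarith)
  refine ⟨T, fun v => (ordAt v x₁ : ℤ) - ordAt v x₂, (x₁ : K) * (x₂ : K)⁻¹,
    mul_ne_zero hx₁K (inv_ne_zero hx₂K), ?_, ?_, ?_, ?_, ?_, ?_, ?_⟩
  · rw [← FractionalIdeal.spanSingleton_mul_spanSingleton, ← FractionalIdeal.spanSingleton_inv,
      spanSingleton_eq_idealProd T hx₁0 hT₁, spanSingleton_eq_idealProd T hx₂0 hT₂,
      ← idealProd_sub]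
    rfl
  · intro σ
    have h1 := (hσx ϑ₂ σ (hBB₂ σ)).1
    rw [← hx₂] at h1
    have hσ0 : σ x₂ ≠ 0 := (map_ne_zero σ).2 hx₂K
    have h2 : σ ((x₁ : K) * (x₂ : K)⁻¹) - 1 = (σ ϑ₂ - σ ϑ₁) / σ x₂ := by
      rw [map_mul, map_inv₀, eq_div_iff hσ0, sub_mul, one_mul, mul_assoc, inv_mul_cancel₀ hσ0,
        mul_one, ← map_sub, ← map_sub]
      rw [hxx, map_sub, map_sub]
    rw [h2, norm_div, div_le_div_iff₀ (by linarith) hn0]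
    have h3 : ‖σ ϑ₂ - σ ϑ₁‖ ≤ 2 * B := by
      refine (norm_sub_le _ _).trans ?_
      linarith [hBB₁ σ, hBB₂ σ]
    have h4 : (4 * B : ℝ) ≤ C := by linarith
    calc ‖σ ϑ₂ - σ ϑ₁‖ * |(n : ℝ)| ≤ 2 * B * |(n : ℝ)| := by gcongr
      _ = 4 * B * (|(n : ℝ)| / 2) := by ring
      _ ≤ C * ‖σ x₂‖ := by gcongr
  · refine hsum.trans ?_
    gcongr
  · intro M hM
    have h1 : Real.log (|(n : ℝ)| / 2) ≤ Real.log (Ideal.absNorm (Ideal.span {x₁})) :=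
      le_log_absNorm_span hx₁0 (by linarith) fun σ => (hσx ϑ₁ σ (hBB₁ σ)).1
    rw [log_absNorm_span_eq_sum T hx₁0 hT₁] at h1
    have h2 : ∀ v ∈ T, (ordAt v x₁ : ℝ) ≤ M + E₀ := by
      intro v hv
      have h3 : ((ordAt v x₁ : ℤ) - ordAt v x₂).natAbs ≤ M := hM v hv
      have h4 := min_le_ordAt_sub v hx₁0 hx₂0 (by rwa [hxx])
      rw [hxx] at h4
      have h5 : ordAt v (ϑ₂ - ϑ₁) ≤ E₀ :=
        (Nat.lt_pow_self (by norm_num)).le.trans (two_pow_ordAt_le v hsub)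
      have h6 : ordAt v x₁ ≤ M + E₀ := by omega
      exact_mod_cast h6
    have h7 : Real.log (|(n : ℝ)| / 2) ≤ (M + E₀) * (D * (1 + Real.log R)) := by
      refine h1.trans (le_trans ?_ (mul_le_mul_of_nonneg_left hsum (by positivity)))
      rw [Finset.mul_sum]
      exact Finset.sum_le_sum fun v hv =>
        mul_le_mul_of_nonneg_right (h2 v hv) (log_absNorm_asIdeal_nonneg v)
    have h8 : Real.log |(n : ℝ)| ≤ 2 * Real.log (|(n : ℝ)| / 2) := by
      have h9 : Real.log |(n : ℝ)| ≤ Real.log ((|(n : ℝ)| / 2) ^ 2) :=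
        Real.log_le_log hn0 (by nlinarith)
      rwa [Real.log_pow] at h9
    have h10 : (M + E₀ : ℝ) ≤ (E₀ + 1) * (M + 1) := by
      nlinarith [(Nat.cast_nonneg E₀ : (0 : ℝ) ≤ E₀), (Nat.cast_nonneg M : (0 : ℝ) ≤ M)]
    calc Real.log |(n : ℝ)| ≤ 2 * ((M + E₀) * (D * (1 + Real.log R))) := by linarith
      _ ≤ 4 * (((E₀ + 1) * (M + 1)) * (D * (1 + Real.log R))) := by
        have : (M + E₀ : ℝ) * (D * (1 + Real.log R)) ≤
          ((E₀ + 1) * (M + 1)) * (D * (1 + Real.log R)) := by gcongr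
        have : (0 : ℝ) ≤ ((E₀ + 1) * (M + 1)) * (D * (1 + Real.log R)) := by positivity
        linarith
      _ = G * (1 + Real.log R) * (M + 1) := by
        rw [hG]
        push_cast
        ring
      _ ≤ C * (1 + Real.log R) * (M + 1) := by gcongr
  · intro v hv
    have h1 : ∀ ϑ : 𝓞 K, (∀ σ : K →+* ℂ, ‖σ ϑ‖ ≤ B) → ∀ h0 : (e * n - ϑ : 𝓞 K) ≠ 0,
        (ordAt v (e * n - ϑ : 𝓞 K) : ℝ) ≤ C * Real.log |(n : ℝ)| := by
      intro ϑ hσ h0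
      have h2 := log_absNorm_span_le h0 fun σ => (hσx ϑ σ (hσ σ)).2
      rw [Real.log_pow] at h2
      have h3 : Real.log ((2 ^ ordAt v (e * n - ϑ : 𝓞 K) : ℕ) : ℝ) ≤
          Real.log (Ideal.absNorm (Ideal.span {(e * n - ϑ : 𝓞 K)})) :=
        Real.log_le_log (by positivity) (by exact_mod_cast two_pow_ordAt_le v h0)
      push_cast at h3 h2
      rw [Real.log_pow] at h3
      have h4 := Real.log_two_gt_d9
      have h5 : (ordAt v (e * n - ϑ : 𝓞 K) : ℝ) ≤ 4 * d * Real.log |(n : ℝ)| := by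
        have h6 : (ordAt v (e * n - ϑ : 𝓞 K) : ℝ) * (1 / 2) ≤
            ordAt v (e * n - ϑ : 𝓞 K) * Real.log 2 := by
          gcongr
          linarith
        linarith
      refine h5.trans (mul_le_mul_of_nonneg_right ?_ hlogn)
      have : 4 * d ≤ C := by omega
      exact_mod_cast this
    have h2 := h1 ϑ₁ hBB₁ hx₁0
    have h3 := h1 ϑ₂ hBB₂ hx₂0
    rw [← hx₁] at h2
    rw [← hx₂] at h3
    have h4 : (((ordAt v x₁ : ℤ) - ordAt v x₂).natAbs : ℝ) ≤ max (ordAt v x₁ : ℝ) (ordAt v x₂) := by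
      have : ((ordAt v x₁ : ℤ) - ordAt v x₂).natAbs ≤ max (ordAt v x₁) (ordAt v x₂) := by omega
      exact_mod_cast this
    exact h4.trans (max_le h2 h3)
  · intro v hv
    obtain ⟨p, hp, -, hpv⟩ := hprime v hv
    have h1 := hord v hv p hp hpv
    have h2 := padicValInt_le_prod hp hm
    calc _ ≤ d * (En + padicValInt p m) := h1
      _ ≤ d * ((En + 1) * (1 + P)) := by
        gcongr
        nlinarith
      _ = D * (1 + P) := by rw [hD]; ring
      _ ≤ C * (1 + P) := by gcongr
  · intro Y hY
    choose! p hp hpd hpv using hprime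
    set A := T.filter fun v => Y ≤ (((ordAt v x₁ : ℤ) - ordAt v x₂).natAbs : ℝ) with hA
    have hC0 : (0 : ℝ) < C := by linarith
    have hlarge : ∀ v ∈ A, Y / C ≤ padicValInt (p v) m := by
      intro v hv
      obtain ⟨hvT, hvY⟩ := Finset.mem_filter.1 hv
      have h1 := hord v hvT (p v) (hp v hvT) (hpv v hvT)
      have h2 : Y ≤ d * (En + padicValInt (p v) m) := hvY.trans (by exact_mod_cast h1)
      have h3 : (2 * d * En : ℝ) ≤ C := by
        have : 2 * d * En ≤ C := by
          rw [mul_assoc]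
          omega
        exact_mod_cast this
      have h4 : (2 * d : ℝ) ≤ C := by
        have : 2 * d ≤ C := by omega
        exact_mod_cast this
      have h5 : (2 * d : ℝ) * padicValInt (p v) m ≤ C * padicValInt (p v) m := by gcongr
      rw [div_le_iff₀ hC0]
      linarith
    have hy : 1 ≤ Y / C := by rwa [le_div_iff₀ hC0, one_mul]
    have h1 := pow_card_le_prod_padicValInt A p hm (d := d) (fun v hv => ?_) (fun q => ?_) hy
      hlarge
    · refine h1.trans (pow_le_pow_right₀ ?_ (by omega))
      exact_mod_cast one_le_prod_padicValInt hm
    · have h1 := hlarge v hv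
      have hvT := (Finset.mem_filter.1 hv).1
      have h2 : (0 : ℝ) < padicValInt (p v) m := by linarith
      have h3 : 0 < padicValInt (p v) m := by exact_mod_cast h2
      refine Nat.mem_primeFactors.2 ⟨hp v hvT, ?_, Int.natAbs_ne_zero.2 hm⟩
      by_contra h4
      rw [padicValInt, padicValNat.eq_zero_of_not_dvd h4] at h3
      exact lt_irrefl _ h3
    · rcases (A.filter fun v => p v = q).eq_empty_or_nonempty with h2 | ⟨w, hw⟩
      · rw [h2]
        exact Nat.zero_le _
      · have hq : q.Prime := by
          have := Finset.mem_filter.1 hw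
          rw [← this.2]
          exact hp w (Finset.mem_filter.1 this.1).1
        refine card_le_finrank_of_prime_mem _ hq fun v hv => ?_
        have := Finset.mem_filter.1 hv
        rw [← this.2]
        exact hpv v (Finset.mem_filter.1 this.1).1

end NumberField

namespace Polynomial

open NumberField

theorem mul_sub_dvd_of_aeval_eq_zero {K : Type*} [Field K] [NumberField K] {F : ℤ[X]} {e : ℤ}
    {x : K} {ϑ : 𝓞 K} (hx : aeval x F = 0) (hϑ : (ϑ : K) = e * x) (n : ℤ) :
    (e * n - ϑ : 𝓞 K) ∣ ((e ^ F.natDegree : ℤ) : 𝓞 K) * (F.eval n : ℤ) := by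
  have h1 : aeval ϑ (F.scaleRoots e) = 0 := by
    have h2 := scaleRoots_aeval_eq_zero (r := e) hx
    rw [eq_intCast, ← hϑ, aeval_algebraMap_apply] at h2
    exact (map_eq_zero_iff _ RingOfIntegers.coe_injective).1 h2
  have h3 : aeval (e * n : 𝓞 K) (F.scaleRoots e) =
      ((e ^ F.natDegree : ℤ) : 𝓞 K) * (F.eval n : ℤ) := by
    have h4 := scaleRoots_eval₂_mul (p := F) (Int.castRingHom (𝓞 K)) (n : 𝓞 K) e
    rw [eq_intCast, ← eq_intCast (Int.castRingHom (𝓞 K)) n, eval₂_at_apply] at h4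
    simpa [aeval_def] using h4
  have h5 := sub_dvd_eval_sub (e * n : 𝓞 K) ϑ ((F.scaleRoots e).map (algebraMap ℤ (𝓞 K)))
  rwa [eval_map_algebraMap, eval_map_algebraMap, h1, h3, sub_zero] at h5

theorem exists_integer_roots {F : ℤ[X]} (hF : F ≠ 0) {z w : ℂ} (hzw : z ≠ w)
    (hz : aeval z F = 0) (hw : aeval w F = 0) :
    ∃ (K : Type) (_ : Field K) (_ : NumberField K) (ϑ₁ ϑ₂ : 𝓞 K) (e E : ℤ), ϑ₁ ≠ ϑ₂ ∧ e ≠ 0 ∧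
      E ≠ 0 ∧ ∀ n : ℤ, (e * n - ϑ₁ : 𝓞 K) ∣ E * (F.eval n : ℤ) ∧
        (e * n - ϑ₂ : 𝓞 K) ∣ E * (F.eval n : ℤ) := by
  have halg : ∀ x : ℂ, aeval x F = 0 → IsIntegral ℚ x := fun x hx => by
    have h1 : IsAlgebraic ℤ x := ⟨F, hF, hx⟩
    exact (h1.extendScalars (S := ℚ) (RingHom.injective_int _)).isIntegral
  let K := IntermediateField.adjoin ℚ ({z, w} : Set ℂ)
  have : FiniteDimensional ℚ K := IntermediateField.finiteDimensional_adjoin fun x hx => by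
    rcases hx with rfl | hx
    · exact halg _ hz
    · rw [Set.mem_singleton_iff.1 hx]
      exact halg _ hw
  have : NumberField K := { }
  let x : K := ⟨z, IntermediateField.subset_adjoin _ _ (by simp)⟩
  let y : K := ⟨w, IntermediateField.subset_adjoin _ _ (by simp)⟩
  have hxy : x ≠ y := fun h => hzw (congrArg Subtype.val h)
  have haev : ∀ t : K, aeval (t : ℂ) F = 0 → aeval t F = 0 := fun t ht => by
    rw [show (t : ℂ) = algebraMap K ℂ t from rfl, aeval_algebraMap_apply] at ht
    exact (map_eq_zero _).1 ht
  have hx : aeval x F = 0 := haev x hz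
  have hy : aeval y F = 0 := haev y hw
  have hxalg : IsAlgebraic ℤ x := ⟨F, hF, hx⟩
  have hyalg : IsAlgebraic ℤ y := ⟨F, hF, hy⟩
  obtain ⟨a, ha0, ha⟩ := hxalg.exists_integral_multiple
  obtain ⟨b, hb0, hb⟩ := hyalg.exists_integral_multiple
  have hab : a * b ≠ 0 := mul_ne_zero ha0 hb0
  have h₁ : IsIntegral ℤ (((a * b : ℤ) : K) * x) := by
    have := ha.smul b
    rw [smul_smul, zsmul_eq_mul, mul_comm b a] at this
    exact this
  have h₂ : IsIntegral ℤ (((a * b : ℤ) : K) * y) := by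
    have := hb.smul a
    rw [smul_smul, zsmul_eq_mul] at this
    exact this
  refine ⟨K, inferInstance, inferInstance, ⟨_, h₁⟩, ⟨_, h₂⟩, a * b, (a * b) ^ F.natDegree, ?_, hab,
    pow_ne_zero _ hab, fun n => ⟨?_, ?_⟩⟩
  · intro h
    exact hxy (mul_left_cancel₀ (Int.cast_ne_zero.2 hab) (congrArg Subtype.val h))
  · exact mul_sub_dvd_of_aeval_eq_zero hx rfl n
  · exact mul_sub_dvd_of_aeval_eq_zero hy rfl n

end Polynomial

theorem Real.twenty_mul_one_add_log_le {t c ℓ M A : ℕ} (hc : 1 ≤ c) (hℓ : 1 ≤ ℓ) (hM : 1 ≤ M)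
    (hMA : Real.log M ≤ A * ℓ) (ht : 12 + 2 * c + A ≤ t) :
    20 * (1 + Real.log (80 * (40 * t * ℓ : ℕ) * (2 * c * ℓ : ℕ) * M)) ≤ (40 * t * ℓ : ℕ) := by
  have hℓ' : (1 : ℝ) ≤ ℓ := by exact_mod_cast hℓ
  have hc' : (1 : ℝ) ≤ c := by exact_mod_cast hc
  have hM' : (1 : ℝ) ≤ M := by exact_mod_cast hM
  have ht' : (12 + 2 * c + A : ℝ) ≤ t := by exact_mod_cast ht
  have hA : (0 : ℝ) ≤ A := Nat.cast_nonneg _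
  have ht0 : (0 : ℝ) < t := by linarith
  have h1 : (80 * (40 * t * ℓ : ℕ) * (2 * c * ℓ : ℕ) * M : ℝ) =
      3200 * t * (2 * c) * ℓ * ℓ * M := by
    push_cast
    ring
  have h3200 : Real.log 3200 ≤ 9 := by
    rw [Real.log_le_iff_le_exp (by norm_num)]
    have h2 := Real.exp_one_gt_d9
    calc (3200 : ℝ) ≤ 2.7 ^ 9 := by norm_num
      _ ≤ Real.exp 1 ^ 9 := by gcongr; linarith
      _ = Real.exp 9 := by rw [← Real.exp_nat_mul]; norm_num
  have h2 : Real.log t ≤ t := Real.log_le_self ht0.le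
  have h3 : Real.log (2 * c) ≤ 2 * c := Real.log_le_self (by positivity)
  have h4 : Real.log ℓ ≤ ℓ := Real.log_le_self (by positivity)
  rw [h1, Real.log_mul (by positivity) (by positivity),
    Real.log_mul (by positivity) (by positivity),
    Real.log_mul (by positivity) (by positivity), Real.log_mul (by positivity) (by positivity),
    Real.log_mul (by positivity) (by positivity)]
  have h5 : 0 ≤ (t - (12 + 2 * c + A : ℝ)) * ℓ := mul_nonneg (by linarith) (by linarith)
  have h6 : 0 ≤ (10 + 2 * c + t : ℝ) * (ℓ - 1) := mul_nonneg (by linarith) (by linarith)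
  push_cast
  nlinarith

theorem Real.mul_pow_le_exp {a S : ℝ} (ha : 0 ≤ a) (hS : 1 ≤ S) (k : ℕ) :
    a * S ^ k ≤ Real.exp ((a + k) * S) := by
  have h1 : S ≤ Real.exp S := by linarith [Real.add_one_le_exp S]
  have h2 : a ≤ Real.exp (a * S) := by nlinarith [Real.add_one_le_exp (a * S)]
  calc a * S ^ k ≤ Real.exp (a * S) * Real.exp S ^ k := by gcongr
    _ = Real.exp ((a + k) * S) := by
      rw [← Real.exp_nat_mul, ← Real.exp_add]
      congr 1
      ring

namespace NumberField

open IsDedekindDomain nonZeroDivisors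

set_option maxHeartbeats 1000000 in
theorem exists_log_le_exp (K : Type*) [Field K] [NumberField K] {ϑ₁ ϑ₂ : 𝓞 K} (hϑ : ϑ₁ ≠ ϑ₂)
    {e E : ℤ} (he : e ≠ 0) (hE : E ≠ 0) (A : ℕ) : ∃ κ : ℝ, 0 < κ ∧ ∀ (n m : ℤ) (L LL : ℝ), m ≠ 0 →
    (e * n - ϑ₁ : 𝓞 K) ∣ E * m → (e * n - ϑ₂ : 𝓞 K) ∣ E * m → 1 ≤ L → 1 ≤ LL → LL ≤ L →
    Real.log L ≤ LL → Real.log ((∏ p ∈ m.natAbs.primeFactors, p : ℕ)) ≤ L →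
    Real.log ((∏ p ∈ m.natAbs.primeFactors, padicValInt p m : ℕ)) ≤ A * L →
    Real.log |(n : ℝ)| ≤ Real.exp (κ * √(L * LL)) := by
  classical
  obtain ⟨c, hc, hc'⟩ := exists_near_one K hϑ he hE
  obtain ⟨C, hC⟩ := lt_pow_card_of_near_one K
  set t := 12 + 4 * c + A with ht
  set q := 154240 * (40 * t) ^ 2 * c ^ 3 with hq
  have hq1 : 1 ≤ q := Nat.mul_pos (by positivity) (by positivity)
  set κ : ℝ := 1 + 14 * c + 3 * (10 + 64 * c * q) +
    3 * (6 * c * A * (q + 8) + C * (C + 1 + (q + 8) + 2 * c + 2)) with hκ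
  have hcR : (1 : ℝ) ≤ c := by exact_mod_cast hc
  have hqR : (1 : ℝ) ≤ q := by exact_mod_cast hq1
  have hAR : (0 : ℝ) ≤ A := Nat.cast_nonneg _
  have hCR : (0 : ℝ) ≤ C := Nat.cast_nonneg _
  have hκ1 : 1 + 14 * c ≤ κ := by
    have : (0 : ℝ) ≤ 3 * (10 + 64 * c * q) +
      3 * (6 * c * A * (q + 8) + C * (C + 1 + (q + 8) + 2 * c + 2)) := by positivity
    rw [hκ]
    linarith
  have hκ2 : 3 * (10 + 64 * c * q) ≤ κ := by
    have : (0 : ℝ) ≤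
      3 * (6 * c * A * (q + 8) + C * (C + 1 + (q + 8) + 2 * c + 2)) := by positivity
    rw [hκ]
    linarith
  have hκ3 : 3 * (6 * c * A * (q + 8) + C * (C + 1 + (q + 8) + 2 * c + 2)) < κ := by
    have : (0 : ℝ) ≤ 3 * (10 + 64 * c * q) := by positivity
    rw [hκ]
    linarith
  clear_value κ
  refine ⟨κ, by linarith, fun n m L LL hm hd₁ hd₂ hL hLL hLLL hlogL hR hP => ?_⟩
  set S := √(L * LL) with hS
  have hS2 : S ^ 2 = L * LL := Real.sq_sqrt (by positivity)
  have hLLS : LL ≤ S := Real.le_sqrt_of_sq_le (by nlinarith)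
  have hS1 : 1 ≤ S := hLL.trans hLLS
  have hLS : L ≤ S ^ 2 := by nlinarith
  by_contra! hx
  set x := Real.log |(n : ℝ)| with hxdef
  have hκS : κ ≤ κ * S := le_mul_of_one_le_right (by linarith) hS1
  have hxκ : κ * S + 1 ≤ x := (Real.add_one_le_exp _).trans hx.le
  have hn0 : (0 : ℝ) < |(n : ℝ)| := by
    by_contra! h
    rw [hxdef, le_antisymm h (abs_nonneg _), Real.log_zero] at hxκ
    linarith
  have hxn : x ≤ |(n : ℝ)| := Real.log_le_self hn0.le
  have hcn : (c : ℤ) ≤ |n| := by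
    have : (c : ℝ) ≤ |(n : ℝ)| := by linarith
    exact_mod_cast this
  obtain ⟨T, b, u, hu, hub, hσ, hsum, hlow, hup, hupP, hcard⟩ := hc' n m hm hcn hd₁ hd₂
  set R := ∏ p ∈ m.natAbs.primeFactors, p with hRdef
  set P := ∏ p ∈ m.natAbs.primeFactors, padicValInt p m with hPdef
  have hP1 : 1 ≤ P := one_le_prod_padicValInt hm
  have hPR : (1 : ℝ) ≤ P := by exact_mod_cast hP1
  set M := T.sup fun v => (b v).natAbs with hM
  have hMle : ∀ v ∈ T, (b v).natAbs ≤ M := fun v hv => Finset.le_sup (f := fun v => (b v).natAbs) hv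
  set ℓ := ⌈L⌉₊ with hℓ
  have hLℓ : L ≤ ℓ := Nat.le_ceil L
  have hℓL : (ℓ : ℝ) ≤ 2 * L := by linarith [Nat.ceil_lt_add_one (by linarith : 0 ≤ L)]
  have hℓR : (1 : ℝ) ≤ ℓ := hL.trans hLℓ
  have hℓ1 : 1 ≤ ℓ := by exact_mod_cast hℓR
  set J := ⌊Real.exp (κ * S / 3)⌋₊ with hJ
  have hJle : (J : ℝ) ≤ Real.exp (κ * S / 3) := Nat.floor_le (Real.exp_pos _).le
  have hJlt : Real.exp (κ * S / 3) < J + 1 := Nat.lt_floor_add_one _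
  have hJ1 : 1 ≤ J := Nat.le_floor (by
    rw [Nat.cast_one]
    exact Real.one_le_exp (by linarith))
  have hJR : (1 : ℝ) ≤ J := by exact_mod_cast hJ1
  have hJQ : (J : ℝ) ^ 2 * (q * ℓ ^ 4 : ℕ) ≤ M := by
    have h1 : 4 * c * L * (q * ℓ ^ 4) ≤ Real.exp (κ * S / 3) := by
      calc 4 * c * L * (q * (ℓ : ℝ) ^ 4) ≤ 4 * c * S ^ 2 * (q * (2 * S ^ 2) ^ 4) := by
            gcongr
            linarith
        _ = (64 * c * q) * S ^ 10 := by ring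
        _ ≤ Real.exp ((64 * c * q + (10 : ℕ)) * S) := Real.mul_pow_le_exp (by positivity) hS1 10
        _ ≤ Real.exp (κ * S / 3) := by
          apply Real.exp_le_exp.2
          push_cast
          have := mul_le_mul_of_nonneg_right hκ2 (by linarith : 0 ≤ S)
          linarith
    have h2 : x ≤ c * (2 * L) * (M + 1) := by
      refine (hlow M hMle).trans ?_
      gcongr
      linarith
    have h3 : Real.exp (κ * S) = Real.exp (κ * S / 3) * Real.exp (κ * S / 3) ^ 2 := by
      rw [← Real.exp_nat_mul, ← Real.exp_add]
      congr 1
      push_cast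
      ring
    have h4 : 4 * c * L * (q * ℓ ^ 4) * (J : ℝ) ^ 2 ≤ c * (2 * L) * (M + 1) := by
      calc 4 * c * L * (q * ℓ ^ 4) * (J : ℝ) ^ 2 ≤
            Real.exp (κ * S / 3) * Real.exp (κ * S / 3) ^ 2 := by gcongr
        _ ≤ _ := by rw [← h3]; linarith
    have h5 : 2 * ((q * ℓ ^ 4) * (J : ℝ) ^ 2) ≤ M + 1 := by
      have : (0 : ℝ) < c * (2 * L) := by positivity
      refine le_of_mul_le_mul_left (le_trans (le_of_eq ?_) h4) this
      ring
    have h6 : (1 : ℝ) ≤ (q * ℓ ^ 4) * (J : ℝ) ^ 2 :=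
      one_le_mul_of_one_le_of_one_le (one_le_mul_of_one_le_of_one_le hqR (one_le_pow₀ hℓR))
        (one_le_pow₀ hJR)
    push_cast
    linarith
  set Q := q * ℓ ^ 4 with hQ
  have hQ1 : 1 ≤ Q := Nat.mul_pos hq1 (by positivity)
  have hQR : (1 : ℝ) ≤ Q := by exact_mod_cast hQ1
  have hJQ' : J ^ 2 * Q ≤ M := by exact_mod_cast hJQ
  have hM0 : 0 < M := lt_of_lt_of_le (by positivity) hJQ'
  have hMR : (0 : ℝ) < M := by exact_mod_cast hM0
  obtain ⟨v₀, hv₀, hv₀M⟩ : ∃ v ∈ T, (b v).natAbs = M := by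
    rcases T.eq_empty_or_nonempty with h | h
    · rw [hM, h, Finset.sup_empty] at hM0
      exact absurd hM0 (lt_irrefl _)
    · obtain ⟨v, hv, hv'⟩ := Finset.exists_mem_eq_sup T h fun v => (b v).natAbs
      exact ⟨v, hv, hv'.symm⟩
  have hMx : (M : ℝ) ≤ c * x := by
    have := hup v₀ hv₀
    rwa [hv₀M] at this
  have hlogM : Real.log M ≤ (2 * c + A : ℕ) * ℓ := by
    have h1 : (M : ℝ) ≤ 2 * c * P := by
      have := hupP v₀ hv₀
      rw [hv₀M] at this
      calc (M : ℝ) ≤ c * (1 + P) := by exact_mod_cast this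
        _ ≤ c * (P + P) := by gcongr
        _ = 2 * c * P := by ring
    have h2 := Real.log_le_log hMR h1
    rw [Real.log_mul (by positivity) (by positivity)] at h2
    have h3 : Real.log (2 * c) ≤ 2 * c := Real.log_le_self (by positivity)
    push_cast
    have h4 : (2 * c : ℝ) ≤ 2 * c * ℓ := le_mul_of_one_le_right (by positivity) hℓR
    have h5 : A * L ≤ A * ℓ := by gcongr
    linarith
  have key := hC T b u M J Q (40 * t * ℓ) (2 * c * ℓ) (x - Real.log c) hu hub hMle ⟨v₀, hv₀, hv₀M⟩
    hM0 hJQ' ?_ ?_ ?_ ?_ ?_ ?_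
  · have hlogℓ : Real.log ℓ ≤ 2 * LL := by
      have h1 := Real.log_le_log (by linarith) hℓL
      rw [Real.log_mul (by norm_num) (by linarith)] at h1
      linarith [Real.log_two_lt_d9]
    have hlogQ : Real.log Q ≤ (q + 8) * LL := by
      rw [hQ]
      push_cast
      rw [Real.log_mul (by positivity) (by positivity), Real.log_pow]
      have h1 : Real.log q ≤ q := Real.log_le_self (by positivity)
      have h2 : (q : ℝ) ≤ q * LL := le_mul_of_one_le_right (by positivity) hLL
      push_cast
      linarith
    set k := (T.filter fun v => M ≤ (b v).natAbs * (J * Q)).card with hk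
    have hkb : k * (κ * S / 6) ≤ c * (A * L) := by
      have hJQ0 : (0 : ℝ) < J * Q := by positivity
      have h1 : (J : ℝ) ≤ M / (J * Q) := by
        rw [le_div_iff₀ hJQ0]
        linarith
      have h2 : c * Real.exp (κ * S / 6) ≤ M / (J * Q) := by
        have h3 : 2 * c ≤ Real.exp (κ * S / 6) := by
          have := Real.add_one_le_exp (κ * S / 6)
          linarith
        have h4 : Real.exp (κ * S / 3) = Real.exp (κ * S / 6) * Real.exp (κ * S / 6) := by
          rw [← Real.exp_add]
          congr 1
          ring
        have h5 : 2 * c * Real.exp (κ * S / 6) ≤ Real.exp (κ * S / 3) := by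
          rw [h4]
          gcongr
        linarith
      have h6 : (c : ℝ) ≤ M / (J * Q) := by
        refine le_trans (le_mul_of_one_le_right (by positivity) (Real.one_le_exp ?_)) h2
        linarith
      have h7 := hcard _ h6
      have h8 : (T.filter fun v => (M / (J * Q) : ℝ) ≤ (b v).natAbs) =
          T.filter fun v => M ≤ (b v).natAbs * (J * Q) := by
        refine Finset.filter_congr fun v _ => ?_
        rw [div_le_iff₀ hJQ0]
        exact_mod_cast Iff.rfl
      rw [h8, ← hk] at h7
      have h9 : Real.exp (κ * S / 6) ^ k ≤ (P : ℝ) ^ c := by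
        refine le_trans (pow_le_pow_left₀ (Real.exp_pos _).le ?_ _) h7
        rw [le_div_iff₀ (by linarith), mul_comm]
        exact h2
      have h10 := Real.log_le_log (by positivity) h9
      rw [Real.log_pow, Real.log_pow, Real.log_exp] at h10
      exact h10.trans (by gcongr)
    have h1 : κ * S / 3 ≤ k * Real.log Q + C * Real.log ((C + 1) * (Q * (2 * c * ℓ))) := by
      rw [← Real.log_pow, ← Real.log_pow, ← Real.log_mul (by positivity) (by positivity),
        Real.le_log_iff_exp_le (by positivity)]
      refine hJlt.le.trans ?_
      have : ((J + 1 : ℕ) : ℝ) ≤ ((Q ^ k * (C * (Q * (2 * c * ℓ))) ^ C : ℕ) : ℝ) :=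
        Nat.cast_le.2 key
      push_cast at this
      refine this.trans ?_
      gcongr
      linarith
    have h2 : Real.log ((C + 1) * (Q * (2 * c * ℓ))) ≤ (C + 1 + (q + 8) + 2 * c + 2) * LL := by
      rw [Real.log_mul (by positivity) (by positivity),
        Real.log_mul (by positivity) (by positivity),
        Real.log_mul (by positivity) (by positivity)]
      have h3 : Real.log (2 * c) ≤ 2 * c := Real.log_le_self (by positivity)
      have h4 : Real.log (C + 1) ≤ C + 1 := Real.log_le_self (by positivity)
      have h5 : (2 * c + (C + 1) : ℝ) ≤ (2 * c + (C + 1)) * LL :=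
        le_mul_of_one_le_right (by positivity) hLL
      linarith
    have h3 : κ * S / 3 ≤ k * ((q + 8) * LL) + C * ((C + 1 + (q + 8) + 2 * c + 2) * LL) := by
      refine h1.trans ?_
      gcongr
    have h4 : k * S ≤ 6 * c * A * L := by
      have : (k : ℝ) * S ≤ k * (κ * S) := by
        gcongr
        nlinarith
      linarith
    have h5 : κ * S / 3 * S ≤
        (6 * c * A * (q + 8) + C * (C + 1 + (q + 8) + 2 * c + 2)) * S ^ 2 := by
      have h6 := mul_le_mul_of_nonneg_right h3 (by linarith : 0 ≤ S)
      have h7 : k * S * ((q + 8) * LL) ≤ 6 * c * A * L * ((q + 8) * LL) := by gcongr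
      have h8 : C * ((C + 1 + (q + 8) + 2 * c + 2) * LL) * S ≤
        C * ((C + 1 + (q + 8) + 2 * c + 2) * S) * S := by gcongr
      have h9 : 6 * c * A * L * ((q + 8) * LL) = 6 * c * A * (q + 8) * S ^ 2 := by
        rw [hS2]
        ring
      linarith
    have h6 : 0 < (κ - 3 * (6 * c * A * (q + 8) + C * (C + 1 + (q + 8) + 2 * c + 2))) * S ^ 2 :=
      mul_pos (by linarith) (by positivity)
    linarith
  · refine hsum.trans ?_
    push_cast
    have : 1 + Real.log R ≤ 2 * ℓ := by linarith
    calc (c : ℝ) * (1 + Real.log R) ≤ c * (2 * ℓ) := by gcongr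
      _ = 2 * c * ℓ := by ring
  · have := Nat.mul_pos hc hℓ1
    nlinarith
  · exact Real.twenty_mul_one_add_log_le hc hℓ1 hM0 hlogM (by omega)
  · rw [hQ, hq]
    have h1 : 1 ≤ 40 * t := by omega
    calc 964 * (40 * t * ℓ) * (2 * c * ℓ) = 1928 * ((40 * t) ^ 1 * c ^ 1 * ℓ ^ 2) := by ring
      _ ≤ 154240 * ((40 * t) ^ 2 * c ^ 3 * ℓ ^ 4) := by
        gcongr <;> norm_num
      _ = _ := by ring
  · have h1 : Real.log c ≤ c := Real.log_le_self (by positivity)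
    have h2 : x / 2 ≤ x - Real.log c := by linarith
    calc (19280 * ((40 * t * ℓ : ℕ) : ℝ) ^ 2 * ((2 * c * ℓ : ℕ) : ℝ) ^ 2 * M : ℝ) ≤
          19280 * ((40 * t * ℓ : ℕ) : ℝ) ^ 2 * ((2 * c * ℓ : ℕ) : ℝ) ^ 2 * (c * x) := by gcongr
      _ = x / 2 * Q := by
        rw [hQ, hq]
        push_cast
        ring
      _ ≤ (x - Real.log c) * Q := by gcongr
  · intro σ
    refine (hσ σ).trans (le_of_eq ?_)
    rw [neg_sub, Real.exp_sub, Real.exp_log (by linarith), hxdef, Real.exp_log hn0]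

end NumberField

/-- Let `F ∈ ℤ[x]` have at least two distinct complex roots.  Suppose there are constants
`μ > 0` and `C > 0` such that for all but finitely many `n ∈ ℤ` with `F(n) ≠ 0` one has
`∏_{p ∣ F(n)} ν_p(F(n)) ≤ C ⬝ rad(F(n))^μ`.  Then there is `κ > 0` such that for all `n`
with `F(n) ≠ 0`, `log |n| ≤ exp(κ √{(log* rad F(n)) (log₂* rad F(n))})`. -/
theorem stmt0 (F : Polynomial ℤ)
    (hroots : ∃ z w : ℂ, z ≠ w ∧ Polynomial.aeval z F = 0 ∧ Polynomial.aeval w F = 0)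
    (μ C : ℝ) (hμ : 0 < μ) (hC : 0 < C)
    (hval : {n : ℤ | F.eval n ≠ 0 ∧
        ¬ (((∏ p ∈ (F.eval n).natAbs.primeFactors, padicValInt p (F.eval n) : ℕ) : ℝ) ≤
          C * (intRadical (F.eval n) : ℝ) ^ μ)}.Finite) :
    ∃ κ : ℝ, 0 < κ ∧ ∀ n : ℤ, F.eval n ≠ 0 →
      Real.log |(n : ℝ)| ≤
        Real.exp (κ * Real.sqrt
          (iterLogStar 1 (intRadical (F.eval n)) * iterLogStar 2 (intRadical (F.eval n)))) := by
  by_cases hF : F = 0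
  · exact ⟨1, one_pos, fun n hn => absurd (by rw [hF, Polynomial.eval_zero]) hn⟩
  obtain ⟨z, w, hzw, hz, hw⟩ := hroots
  obtain ⟨K, _, _, ϑ₁, ϑ₂, e, E, hϑ, he, hE, hdvd⟩ :=
    Polynomial.exists_integer_roots hF hzw hz hw
  obtain ⟨A, hA⟩ := exists_nat_ge (|Real.log C| + μ)
  obtain ⟨κ, hκ0, hκ⟩ := NumberField.exists_log_le_exp K hϑ he hE A
  obtain ⟨N, hN⟩ := (hval.image fun n : ℤ => |(n : ℝ)|).bddAbove
  have hκN : 0 < κ + |N| := by positivity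
  refine ⟨κ + |N|, hκN, fun n hn => ?_⟩
  have hR : 1 ≤ intRadical (F.eval n) :=
    Finset.prod_pos fun p hp => (Nat.prime_of_mem_primeFactors hp).pos
  have hR' : (1 : ℝ) ≤ intRadical (F.eval n) := by exact_mod_cast hR
  set L := iterLogStar 1 (intRadical (F.eval n)) with hL
  set LL := iterLogStar 2 (intRadical (F.eval n)) with hLL
  have hL' : L = max 1 (Real.log (intRadical (F.eval n))) := by
    rw [hL, iterLogStar, iterLogStar, max_eq_right hR']
  have hLL' : LL = max 1 (Real.log L) := rfl
  have hL1 : 1 ≤ L := hL' ▸ le_max_left _ _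
  have hLL1 : 1 ≤ LL := le_max_left _ _
  have hS : 1 ≤ √(L * LL) := Real.one_le_sqrt.2 (one_le_mul_of_one_le_of_one_le hL1 hLL1)
  have hlogR : Real.log (intRadical (F.eval n)) ≤ L := hL' ▸ le_max_right _ _
  by_cases hv : ((∏ p ∈ (F.eval n).natAbs.primeFactors, padicValInt p (F.eval n) : ℕ) : ℝ) ≤
      C * (intRadical (F.eval n) : ℝ) ^ μ
  · have hP : (0 : ℝ) < (∏ p ∈ (F.eval n).natAbs.primeFactors, padicValInt p (F.eval n) : ℕ) :=
      Nat.cast_pos.2 (one_le_prod_padicValInt hn)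
    refine (hκ n (F.eval n) L LL hn (hdvd n).1 (hdvd n).2 hL1 hLL1
      (max_le hL1 (Real.log_le_self (by linarith))) (le_max_right _ _) hlogR ?_).trans ?_
    · refine (Real.log_le_log hP hv).trans ?_
      rw [Real.log_mul hC.ne' (by positivity), Real.log_rpow (by linarith)]
      have h1 : |Real.log C| ≤ |Real.log C| * L := le_mul_of_one_le_right (abs_nonneg _) hL1
      have h2 := le_abs_self (Real.log C)
      have h3 : μ * Real.log (intRadical (F.eval n)) ≤ μ * L := by gcongr
      have h4 : (|Real.log C| + μ) * L ≤ A * L := by gcongr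
      linarith
    · gcongr
      exact le_add_of_nonneg_right (abs_nonneg N)
  · have h1 : |(n : ℝ)| ≤ N := hN ⟨n, ⟨hn, hv⟩, rfl⟩
    calc Real.log |(n : ℝ)| ≤ |(n : ℝ)| := Real.log_le_self (abs_nonneg _)
      _ ≤ |N| := h1.trans (le_abs_self N)
      _ ≤ κ + |N| := le_add_of_nonneg_left hκ0.le
      _ ≤ (κ + |N|) * √(L * LL) := le_mul_of_one_le_right hκN.le hS
      _ ≤ (κ + |N|) * √(L * LL) + 1 := by linarith
      _ ≤ _ := Real.add_one_le_exp _
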